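/- arXiv:1610.01521 — 3 statements merged into one kernel-verified Lean document; each statement's English description precedes it below -/
import Mathlib

section
/- Let k be a positive integer. There exists a constant n0(k) such that for every n ≥ n0(k) the following holds: if S ⊆ {0,1,2}^n and t is a nonnegative integer such that |S| ≥ (Σ_{r = n−⌊(k−1)/2⌋}^{n+⌈(k−1)/2⌉} ℓ_r(n)) + t, then comp(S) ≥ (ℓ_{3k−1}(n)/ℓ_{2k−1}(n) − 1) · t, where the right-hand side is a rational number and the inequality is between rationals. -/
/-- The number of comparable pairs (unordered pairs of distinct comparable elements)
in a finite subset `S` of a poset. -/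
noncomputable def compPairs {α : Type*} [PartialOrder α] (S : Finset α) : ℕ :=
  Nat.card {p : α × α // p.1 ∈ S ∧ p.2 ∈ S ∧ p.1 < p.2}

/-- `ℓ_i(n)`: the number of elements of `{0,1,2}^n` whose coordinates sum to `i`. -/
noncomputable def ell (n i : ℕ) : ℕ :=
  Nat.card {x : Fin n → Fin 3 // ∑ j, (x j : ℕ) = i}

namespace MultisetSupersaturation

open Finset

section levels

open Polynomial

/-- The rank of an element of `{0,1,2}^n`. -/
def rk {n : ℕ} (x : Fin n → Fin 3) : ℕ := ∑ j, (x j : ℕ)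

/-- Coordinatewise complement `v ↦ 2 - v`. -/
def mir {n : ℕ} (x : Fin n → Fin 3) : Fin n → Fin 3 := fun j => (x j).rev

lemma mir_mir {n : ℕ} (x : Fin n → Fin 3) : mir (mir x) = x := by
  funext j; simp [mir]

lemma rk_mir_add {n : ℕ} (x : Fin n → Fin 3) : rk (mir x) + rk x = 2 * n := by
  unfold rk mir
  rw [← sum_add_distrib]
  have : ∀ j : Fin n, (((x j).rev : Fin 3) : ℕ) + (x j : ℕ) = 2 := by
    intro j
    have := (x j).isLt
    rw [Fin.val_rev]; omega
  rw [sum_congr rfl fun j _ => this j]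
  simp [mul_comm]

lemma rk_le {n : ℕ} (x : Fin n → Fin 3) : rk x ≤ 2 * n := by
  have := rk_mir_add x; omega

lemma ell_eq_card (n i : ℕ) :
    ell n i = #(univ.filter fun x : Fin n → Fin 3 => rk x = i) := by
  rw [ell, Nat.card_eq_fintype_card, Fintype.card_subtype]
  rfl

lemma ell_eq_coeff (n i : ℕ) : ell n i = ((1 + X + X ^ 2 : ℕ[X]) ^ n).coeff i := by
  have h : (1 + X + X ^ 2 : ℕ[X]) = ∑ v : Fin 3, X ^ (v : ℕ) := by
    simp [Fin.sum_univ_three]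
  rw [h, Fintype.sum_pow, finsetSum_coeff, ell_eq_card, card_filter]
  refine sum_congr rfl fun x _ => ?_
  rw [prod_pow_eq_pow_sum, coeff_X_pow]
  simp [rk, eq_comm]

lemma ell_symm (n i : ℕ) (hi : i ≤ 2 * n) : ell n i = ell n (2 * n - i) := by
  rw [ell_eq_card, ell_eq_card]
  refine card_bij' (fun x _ => mir x) (fun x _ => mir x) ?_ ?_ ?_ ?_
  · intro x hx
    have := rk_mir_add x
    simp only [mem_filter, mem_univ, true_and] at hx ⊢
    omega
  · intro x hx
    have := rk_mir_add x
    simp only [mem_filter, mem_univ, true_and] at hx ⊢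
    omega
  · intro x _; exact mir_mir x
  · intro x _; exact mir_mir x

lemma ell_succ (n i : ℕ) : ell (n + 1) (i + 2) = ell n (i + 2) + ell n (i + 1) + ell n i := by
  simp only [ell_eq_coeff]
  rw [pow_succ, mul_add, mul_add, coeff_add, coeff_add, mul_one, coeff_mul_X, coeff_mul_X_pow]

lemma ell_succ_one (n : ℕ) : ell (n + 1) 1 = ell n 1 + ell n 0 := by
  simp only [ell_eq_coeff]
  rw [pow_succ, mul_add, mul_add, coeff_add, coeff_add, mul_one,
    show (1 : ℕ) = 0 + 1 from rfl, coeff_mul_X, zero_add, coeff_mul_X_pow']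
  simp

lemma ell_zero (n : ℕ) : ell n 0 = 1 := by
  rw [ell_eq_coeff, coeff_zero_eq_eval_zero]; simp

lemma ell_le_succ (n i : ℕ) (hi : i < n) : ell n i ≤ ell n (i + 1) := by
  induction n generalizing i with
  | zero => omega
  | succ n ih =>
    have mono : ∀ a b, a ≤ b → b ≤ n → ell n a ≤ ell n b := by
      intro a b hab
      induction b, hab using Nat.le_induction with
      | base => intro _; exact le_rfl
      | succ b _ ihb => intro hb; exact (ihb (by omega)).trans (ih b (by omega))
    match i with
    | 0 =>
      rw [ell_succ_one]; simp [ell_zero]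
    | 1 =>
      have h := ell_succ n 0
      rw [zero_add, zero_add] at h
      rw [ell_succ_one, h]; omega
    | i + 2 =>
      rw [ell_succ, show i + 2 + 1 = (i + 1) + 2 from rfl, ell_succ]
      suffices ell n i ≤ ell n (i + 1 + 2) by
        rw [show i + 1 + 1 = i + 2 from rfl]; omega
      rcases Nat.lt_or_ge (i + 2) n with h | h
      · exact mono _ _ (by omega) (by omega)
      · obtain rfl : n = i + 2 := by omega
        rw [ell_symm (i + 2) (i + 1 + 2) (by omega)]
        exact mono _ _ (by omega) (by omega)

lemma ell_mono {n a b : ℕ} (hab : a ≤ b) (hb : b ≤ n) : ell n a ≤ ell n b := by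
  induction b, hab using Nat.le_induction with
  | base => exact le_rfl
  | succ b _ ihb => exact (ihb (by omega)).trans (ell_le_succ n b (by omega))

/-- Levels closer to the middle are larger. -/
lemma ell_le_of_dist {n a b : ℕ} (ha : a ≤ 2 * n) (h2 : b ≤ 2 * n)
    (h : min b (2 * n - b) ≤ min a (2 * n - a)) : ell n b ≤ ell n a := by
  have key : ∀ c ≤ 2 * n, ell n c = ell n (min c (2 * n - c)) := by
    intro c hc
    rcases le_total c (2 * n - c) with h | h
    · rw [min_eq_left h]
    · rw [min_eq_right h]; exact ell_symm n c hc
  rw [key a ha, key b h2]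
  exact ell_mono h (by omega)

lemma succ_mul_ell (n s : ℕ) :
    (s + 1) * ell (n + 1) (s + 1) = (n + 1) * (ell n s + 2 * (if s = 0 then 0 else ell n (s - 1))) := by
  have h := congrArg (fun p => coeff p s) (derivative_pow_succ (1 + X + X ^ 2 : ℕ[X]) n)
  simp only [coeff_derivative] at h
  rw [← ell_eq_coeff] at h
  have h2 : derivative (1 + X + X ^ 2 : ℕ[X]) = 1 + C 2 * X := by
    simp
  have h3 : C ((n : ℕ) + 1) * (1 + X + X ^ 2 : ℕ[X]) ^ n * (1 + C 2 * X) =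
      C ((n : ℕ) + 1) * ((1 + X + X ^ 2) ^ n + C 2 * ((1 + X + X ^ 2) ^ n * X)) := by ring
  simp only [Nat.cast_id] at h
  rw [h2, h3, coeff_C_mul, coeff_add, coeff_C_mul, ← ell_eq_coeff] at h
  cases s with
  | zero => simp at h ⊢; linarith
  | succ s =>
    rw [coeff_mul_X, ← ell_eq_coeff] at h
    simp at h ⊢; linarith

lemma mul_ell_le (n s : ℕ) (hs : s < n) : n * ell n s ≤ (s + 1) * ell n (s + 1) := by
  obtain ⟨n, rfl⟩ : ∃ m, n = m + 1 := ⟨n - 1, by omega⟩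
  rw [succ_mul_ell]
  refine Nat.mul_le_mul_left _ ?_
  match s with
  | 0 => simp [ell_zero]
  | 1 => rw [ell_succ_one]; simp; omega
  | s + 2 =>
    have := ell_le_succ n s (by omega)
    rw [ell_succ]; simp; omega

lemma mul_ell_ge (n s : ℕ) : (s + 1) * ell n (s + 1) ≤ (n + s) * ell n s := by
  cases n with
  | zero =>
    have : ell 0 (s + 1) = 0 := by rw [ell_eq_coeff]; simp [coeff_one]
    simp [this]
  | succ n =>
    have h1 := succ_mul_ell n s
    rw [h1]
    match s with
    | 0 => simp [ell_zero]
    | 1 =>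
      have h0 := succ_mul_ell n 0
      simp [ell_zero] at h0 ⊢
      rw [h0, add_mul]
      have := ell_succ_one n
      rw [ell_zero, h0] at this
      have h3 : (n+1) * (ell n 1 + 2) = (n+1) * ell n 1 + 2 * (n+1) := by ring
      nlinarith
    | s + 2 =>
      have h2 := succ_mul_ell n (s + 1)
      have h3 := ell_succ n s
      simp only [Nat.add_eq_zero_iff, OfNat.ofNat_ne_zero, and_false, one_ne_zero, if_false] at h2 ⊢
      rw [show s + 1 + 1 = s + 2 from rfl] at h2
      simp only [Nat.add_sub_cancel, show s + 2 - 1 = s + 1 from rfl] at h2 ⊢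
      have h4 : (n + 1 + (s + 2)) * ell (n + 1) (s + 2) =
          (n + 1) * (ell n (s + 2) + ell n (s + 1) + ell n s) +
            (n + 1) * (ell n (s + 1) + 2 * ell n s) := by
        rw [← h2, ← h3]; ring
      rw [h4]
      nlinarith [Nat.zero_le ((n + 1) * ell n s)]

lemma ell_pos {n i : ℕ} (hi : i ≤ 2 * n) : 0 < ell n i := by
  have h : ∀ j ≤ n, 0 < ell n j := fun j hj =>
    lt_of_lt_of_le (by rw [ell_zero]; exact Nat.one_pos) (ell_mono (Nat.zero_le j) hj)
  rcases le_total i n with h' | h'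
  · exact h i h'
  · rw [ell_symm n i hi]; exact h _ (by omega)

/-- Number of elements of `{0,1,2}^n` of rank `s` with exactly `c` coordinates equal to `2`. -/
def typ (n s c : ℕ) : ℕ := if 2 * c ≤ s then n.choose c * (n - c).choose (s - 2 * c) else 0

lemma sum_typ (n s m : ℕ) (hm : s ≤ 2 * m + 1) : ∑ c ∈ range (m + 1), typ n s c = ell n s := by
  have h : (1 + X + X ^ 2 : ℕ[X]) ^ n =
      ∑ c ∈ range (n + 1), C (n.choose c) * ((1 + X) ^ (n - c) * X ^ (2 * c)) := by
    rw [add_comm, add_pow]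
    refine sum_congr rfl fun c _ => ?_
    rw [← pow_mul, ← C_eq_natCast, Nat.cast_id]; ring
  have h1 : ∀ c, (C (n.choose c) * ((1 + X : ℕ[X]) ^ (n - c) * X ^ (2 * c))).coeff s = typ n s c := by
    intro c
    rw [coeff_C_mul, coeff_mul_X_pow', coeff_one_add_X_pow, typ]
    split_ifs <;> simp
  rw [ell_eq_coeff, h, finsetSum_coeff]
  simp only [h1]
  have h2 : ∀ c, n < c → typ n s c = 0 := by
    intro c hc; simp [typ, Nat.choose_eq_zero_of_lt hc]
  have h3 : ∀ c, m < c → typ n s c = 0 := by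
    intro c hc; simp [typ]; intro; omega
  rcases le_total m n with h | h
  · refine sum_subset (range_mono (by omega)) ?_
    intro c _ hc; exact h3 c (by simpa using hc)
  · symm
    refine sum_subset (range_mono (by omega)) ?_
    intro c _ hc; exact h2 c (by simpa using hc)

end levels

lemma typ_mul_zeros (n s c : ℕ) (hs : s ≤ n) (hc : 2 * c ≤ s + 1) :
    (typ n s c : ℝ) * ((n : ℝ) - s + c) = typ n (s + 1) c * ((s : ℝ) + 1 - 2 * c) := by
  rcases Nat.lt_or_ge s (2 * c) with h | h
  · have : (s : ℝ) + 1 = 2 * c := by exact_mod_cast (by omega : s + 1 = 2 * c)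
    simp [typ, h.not_ge, this]
  · obtain ⟨b, rfl⟩ := Nat.exists_eq_add_of_le h
    obtain ⟨a, rfl⟩ := Nat.exists_eq_add_of_le hs
    have h1 := Nat.choose_succ_right_eq (c + b + a) b
    rw [typ, typ, if_pos (by omega), if_pos (by omega),
      show 2 * c + b + a - c = c + b + a by omega, show 2 * c + b - 2 * c = b by omega,
      show 2 * c + b + 1 - 2 * c = b + 1 by omega]
    rw [show c + b + a - b = a + c by omega] at h1
    have h2 : (((c + b + a).choose (b + 1) : ℕ) : ℝ) * (b + 1) = (c + b + a).choose b * (a + c) := by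
      exact_mod_cast h1
    push_cast
    linear_combination (-((2 * c + b + a).choose c : ℝ)) * h2

lemma typ_mul_ones (n s c : ℕ) (hs : s ≤ n) (hc : 2 * c ≤ s) :
    (typ n s c : ℝ) * ((s : ℝ) - 2 * c) = typ n (s + 1) (c + 1) * ((c : ℝ) + 1) := by
  obtain ⟨b, rfl⟩ := Nat.exists_eq_add_of_le hc
  cases b with
  | zero => simp [typ]; intro; omega
  | succ b =>
    obtain ⟨a, rfl⟩ := Nat.exists_eq_add_of_le hs
    have h1 := Nat.choose_succ_right_eq (2 * c + (b + 1) + a) c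
    have h2 := Nat.add_one_mul_choose_eq (c + b + a) b
    rw [typ, typ, if_pos (by omega), if_pos (by omega),
      show 2 * c + (b + 1) + a - c = c + b + a + 1 by omega,
      show 2 * c + (b + 1) + a - (c + 1) = c + b + a by omega,
      show 2 * c + (b + 1) - 2 * c = b + 1 by omega,
      show 2 * c + (b + 1) + 1 - 2 * (c + 1) = b by omega]
    rw [show 2 * c + (b + 1) + a - c = c + b + a + 1 by omega] at h1
    set N := 2 * c + (b + 1) + a
    have h1' : ((N.choose (c + 1) : ℕ) : ℝ) * (c + 1) = N.choose c * (c + b + a + 1) := by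
      exact_mod_cast h1
    have h2' : ((c : ℝ) + b + a + 1) * ((c + b + a).choose b : ℕ) =
        ((c + b + a + 1).choose (b + 1) : ℕ) * (b + 1) := by
      exact_mod_cast h2
    push_cast
    linear_combination (-(N.choose c : ℝ)) * h2' - ((c + b + a).choose b : ℝ) * h1'

lemma typ_pos (n s c : ℕ) (hs : s ≤ n) (hc : 2 * c ≤ s) : 0 < typ n s c := by
  rw [typ, if_pos hc]
  exact Nat.mul_pos (Nat.choose_pos (by omega)) (Nat.choose_pos (by omega))

lemma partial_sum_nonpos (g : ℕ → ℝ) (M : ℕ)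
    (hg : ∀ c c', c < c' → c' ≤ M → 0 < g c → 0 ≤ g c')
    (hM : ∑ i ∈ range (M + 1), g i ≤ 0) (m : ℕ) (hm : m ≤ M) :
    ∑ i ∈ range (m + 1), g i ≤ 0 := by
  by_contra! hpos
  obtain ⟨c, hc, hgc⟩ : ∃ c ∈ range (m + 1), 0 < g c := by
    by_contra! h
    exact absurd (sum_nonpos h) (not_le.mpr hpos)
  have h1 : ∑ i ∈ range (m + 1), g i ≤ ∑ i ∈ range (M + 1), g i := by
    refine sum_le_sum_of_subset_of_nonneg (range_mono (by omega)) fun i hi hi' => ?_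
    simp only [mem_range] at hi hi' hc
    exact hg c i (by omega) (by omega) hgc
  linarith

/-- Telescoping of a sequence of differences. -/
lemma sum_range_diff (f : ℕ → ℝ) (m : ℕ) :
    ∑ i ∈ range (m + 1), (f i - if i = 0 then 0 else f (i - 1)) = f m := by
  induction m with
  | zero => simp
  | succ m ih => rw [sum_range_succ, ih]; simp

section flow

variable {n s : ℕ}

/-- The ratio of the sizes of consecutive levels. -/
noncomputable def rat (n s : ℕ) : ℝ := (ell n s : ℝ) / ell n (s + 1)

/-- The bound on the transition probabilities below the middle level. -/
noncomputable def lam (n : ℕ) : ℝ := 2 / ((n : ℝ) - 1)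

lemma ell_pos' {n i : ℕ} (hi : i ≤ 2 * n) : (0 : ℝ) < ell n i := by exact_mod_cast ell_pos hi

lemma rat_le (hs : s < n) : rat n s ≤ ((s : ℝ) + 1) / n := by
  have h1 := ell_pos' (n := n) (i := s + 1) (by omega)
  have hn : (0 : ℝ) < n := by exact_mod_cast (by omega : 0 < n)
  rw [rat, div_le_div_iff₀ h1 hn]
  have := mul_ell_le n s hs
  have : (n : ℝ) * ell n s ≤ (s + 1) * ell n (s + 1) := by exact_mod_cast this
  linarith

lemma rat_ge (hs : s < 2 * n) : ((s : ℝ) + 1) / (n + s) ≤ rat n s := by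
  have h1 := ell_pos' (n := n) (i := s + 1) (by omega)
  have hn : (0 : ℝ) < n + s := by exact_mod_cast (by omega : 0 < n + s)
  rw [rat, div_le_div_iff₀ hn h1]
  have := mul_ell_ge n s
  have : ((s : ℝ) + 1) * ell n (s + 1) ≤ (n + s) * ell n s := by exact_mod_cast this
  linarith

lemma rat_pos (hs : s < 2 * n) : 0 < rat n s :=
  div_pos (ell_pos' (by omega)) (ell_pos' (by omega))

/-- Probability that a uniform element of level `s` has type `c`. -/
noncomputable def prb (n s c : ℕ) : ℝ := typ n s c / ell n s

lemma sum_prb (m : ℕ) (hs : s ≤ 2 * n) (hm : s ≤ 2 * m + 1) :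
    ∑ c ∈ range (m + 1), prb n s c = 1 := by
  have h := ell_pos' hs
  simp only [prb]
  rw [← sum_div, ← Nat.cast_sum, sum_typ n s m hm, div_self h.ne']

/-- Amount of probability moved from type `c` to type `c + 1` between levels `s` and `s + 1`. -/
noncomputable def flowUp (n s c : ℕ) : ℝ := ∑ i ∈ range (c + 1), (prb n s i - prb n (s + 1) i)

/-- Common factor of the quantities `prb` near type `c`. -/
noncomputable def base (n s c : ℕ) : ℝ := typ n (s + 1) c / ell n s

lemma base_nonneg (c : ℕ) : 0 ≤ base n s c := by unfold base; positivity

lemma prb_nonneg (c : ℕ) : 0 ≤ prb n s c := by unfold prb; positivity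

lemma prb_succ_eq (hs : s < n) (c : ℕ) : prb n (s + 1) c = base n s c * rat n s := by
  have := ell_pos' (n := n) (i := s) (by omega)
  unfold prb base rat; field_simp

lemma zeros_pos (hs : s < n) (c : ℕ) : (0 : ℝ) < (n : ℝ) - s + c := by
  have : (s : ℝ) + 1 ≤ n := by exact_mod_cast hs
  have : (0 : ℝ) ≤ c := by positivity
  linarith

lemma zeros_mul_prb (hs : s < n) {c : ℕ} (hc : 2 * c ≤ s + 1) :
    ((n : ℝ) - s + c) * prb n s c = base n s c * ((s : ℝ) + 1 - 2 * c) := by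
  have := typ_mul_zeros n s c hs.le hc
  unfold prb base
  rw [mul_div_assoc', mul_comm _ (typ n s c : ℝ), this]; ring

lemma ones_mul_prb_pred (hs : s < n) {c : ℕ} (hc : 2 * (c + 1) ≤ s + 1) :
    ((s : ℝ) - 2 * c) * prb n s c = base n s (c + 1) * (c + 1) := by
  have := typ_mul_ones n s c hs.le (by omega)
  unfold prb base
  rw [mul_div_assoc', mul_comm _ (typ n s c : ℝ), this]; ring

lemma ones_mul_prb_pred' (hs : s < n) {i : ℕ} (hi : 2 * i ≤ s + 1) :
    (if i = 0 then 0 else ((s : ℝ) - 2 * (i - 1 : ℕ)) * prb n s (i - 1)) = base n s i * i := by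
  cases i with
  | zero => simp
  | succ i => simpa using ones_mul_prb_pred hs hi

lemma flowUp_top (hs : s < n) : flowUp n s ((s + 1) / 2) = 0 := by
  rw [flowUp, sum_sub_distrib, sum_prb _ (by omega) (by omega), sum_prb _ (by omega) (by omega),
    sub_self]

lemma flowUp_nonneg (hs : s < n) {c : ℕ} (hc : 2 * c ≤ s + 1) : 0 ≤ flowUp n s c := by
  have hr := rat_pos (n := n) (s := s) (by omega)
  have hg : ∀ i, 2 * i ≤ s + 1 → ((n : ℝ) - s + i) * (prb n (s + 1) i - prb n s i) =
      base n s i * (rat n s * ((n : ℝ) - s + i) - ((s : ℝ) + 1 - 2 * i)) := by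
    intro i hi
    rw [mul_sub, zeros_mul_prb hs hi, prb_succ_eq hs]; ring
  have := partial_sum_nonpos (fun i => prb n (s + 1) i - prb n s i) ((s + 1) / 2) ?_ ?_ c (by omega)
  · rw [sum_sub_distrib] at this
    rw [flowUp, sum_sub_distrib]; linarith
  · intro i i' hii hi' hpos
    have h1 := mul_pos (zeros_pos hs i) hpos
    rw [hg i (by omega)] at h1
    have h2 := pos_of_mul_pos_right h1 (base_nonneg i)
    refine nonneg_of_mul_nonneg_right (?_ : 0 ≤ ((n : ℝ) - s + i') * _) (zeros_pos hs i')
    rw [hg i' (by omega)]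
    refine mul_nonneg (base_nonneg i') ?_
    have : (i : ℝ) ≤ i' := by exact_mod_cast hii.le
    nlinarith
  · have := flowUp_top hs
    rw [flowUp, sum_sub_distrib] at this
    rw [sum_sub_distrib]; linarith

/-- Amount of probability staying at type `c` between levels `s` and `s + 1`. -/
noncomputable def flowStay (n s c : ℕ) : ℝ := prb n s c - flowUp n s c

lemma flowStay_eq_sum (c : ℕ) : flowStay n s c =
    ∑ i ∈ range (c + 1), (prb n (s + 1) i - if i = 0 then 0 else prb n s (i - 1)) := by
  rw [flowStay, flowUp, ← sum_range_diff (fun i => prb n s i) c, ← sum_sub_distrib]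
  refine sum_congr rfl fun i _ => ?_
  ring

lemma stay_term (hs : s < n) {i : ℕ} (hi : 2 * i ≤ s + 1) :
    ((s : ℝ) + 2 - 2 * i) * (prb n (s + 1) i - if i = 0 then 0 else prb n s (i - 1)) =
      base n s i * (rat n s * ((s : ℝ) + 2 - 2 * i) - i) := by
  have h := ones_mul_prb_pred' hs hi
  rw [prb_succ_eq hs]
  cases i with
  | zero => simp; ring
  | succ i => simp at h ⊢; linear_combination -h

lemma ones_add_two_pos {i : ℕ} (hi : 2 * i ≤ s + 1) : (0 : ℝ) < (s : ℝ) + 2 - 2 * i := by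
  have : 2 * (i : ℝ) ≤ s + 1 := by exact_mod_cast hi
  linarith

lemma flowStay_top (hs : s < n) : 0 ≤ flowStay n s ((s + 1) / 2) := by
  rw [flowStay, flowUp_top hs, sub_zero]; exact prb_nonneg _

lemma flowStay_nonneg (hs : s < n) {c : ℕ} (hc : 2 * c ≤ s + 1) : 0 ≤ flowStay n s c := by
  have hr := rat_pos (n := n) (s := s) (by omega)
  have := partial_sum_nonpos
    (fun i => -(prb n (s + 1) i - if i = 0 then 0 else prb n s (i - 1))) ((s + 1) / 2) ?_ ?_ c
    (by omega)
  · rw [sum_neg_distrib, ← flowStay_eq_sum] at this; linarith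
  · intro i i' hii hi' hpos
    have h1 := mul_pos (ones_add_two_pos (s := s) (i := i) (by omega)) hpos
    rw [mul_neg, stay_term hs (by omega), ← mul_neg] at h1
    have h2 := pos_of_mul_pos_right h1 (base_nonneg i)
    refine nonneg_of_mul_nonneg_right (?_ : 0 ≤ ((s : ℝ) + 2 - 2 * i') * _)
      (ones_add_two_pos (s := s) (by omega))
    rw [mul_neg, stay_term hs (by omega), ← mul_neg]
    refine mul_nonneg (base_nonneg i') ?_
    have : (i : ℝ) ≤ i' := by exact_mod_cast hii.le
    nlinarith
  · rw [sum_neg_distrib, ← flowStay_eq_sum]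
    have := flowStay_top hs
    linarith

lemma lam_pos (hn : 2 ≤ n) : 0 < lam n := by
  have : (2 : ℝ) ≤ n := by exact_mod_cast hn
  unfold lam; exact div_pos two_pos (by linarith)

lemma lam_mul (hn : 2 ≤ n) : lam n * ((n : ℝ) - 1) = 2 := by
  have : (2 : ℝ) ≤ n := by exact_mod_cast hn
  unfold lam; exact div_mul_cancel₀ _ (by linarith)

lemma nonneg_of_concave {A x y z P Q R : ℝ} (hxy : x < y) (hyz : y ≤ z) (hA : A ≤ 0)
    (hP : 0 ≤ P) (hR : 0 ≤ R)
    (h : (z - y) * P + (y - x) * R - (z - x) * Q = A * ((z - x) * (z - y) * (y - x))) : 0 ≤ Q := by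
  have h1 : 0 ≤ (z - x) * (z - y) * (y - x) :=
    mul_nonneg (mul_nonneg (by linarith) (by linarith)) (by linarith)
  have h2 := mul_nonneg (sub_nonneg.mpr hyz) hP
  have h3 := mul_nonneg (sub_nonneg.mpr hxy.le) hR
  have h4 := mul_nonneg (neg_nonneg.mpr hA) h1
  exact nonneg_of_mul_nonneg_right (by linarith : 0 ≤ (z - x) * Q) (by linarith)

lemma flowUp_le (hs : s < n) (hn : 2 ≤ n) {c : ℕ} (hc : 2 * c ≤ s + 1) :
    flowUp n s c ≤ lam n * (((s : ℝ) - 2 * c) * prb n s c) := by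
  have hr := rat_pos (n := n) (s := s) (by omega)
  have hl := lam_pos hn
  set f : ℕ → ℝ := fun i => ((s : ℝ) - 2 * i) * prb n s i with hf
  have hsum : ∀ m, ∑ i ∈ range (m + 1), ((prb n s i - prb n (s + 1) i) -
      lam n * (f i - if i = 0 then 0 else f (i - 1))) = flowUp n s m - lam n * f m := by
    intro m
    rw [sum_sub_distrib, ← mul_sum, sum_range_diff f m, flowUp]
  have hterm : ∀ i, 2 * i ≤ s + 1 → ((n : ℝ) - s + i) * ((prb n s i - prb n (s + 1) i) -
      lam n * (f i - if i = 0 then 0 else f (i - 1))) = base n s i *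
      (((s : ℝ) + 1 - 2 * i) * (1 - lam n * (s - 2 * i)) - rat n s * ((n : ℝ) - s + i) +
        lam n * i * ((n : ℝ) - s + i)) := by
    intro i hi
    have h1 := ones_mul_prb_pred' hs hi
    have h2 := zeros_mul_prb hs hi
    rw [prb_succ_eq hs, hf]
    simp only
    rw [h1]
    linear_combination (1 - lam n * (s - 2 * i)) * h2
  have htop : 0 ≤ (((s : ℝ) + 1 - 2 * ((s + 1) / 2 : ℕ)) * (1 - lam n * (s - 2 * ((s + 1) / 2 : ℕ)))
      - rat n s * ((n : ℝ) - s + ((s + 1) / 2 : ℕ)) +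
        lam n * ((s + 1) / 2 : ℕ) * ((n : ℝ) - s + ((s + 1) / 2 : ℕ))) := by
    have hrl := rat_le hs
    have hn0 : (0 : ℝ) < n := by exact_mod_cast (by omega : 0 < n)
    have hsn : (s : ℝ) + 1 ≤ n := by exact_mod_cast hs
    have hln : 2 / (n : ℝ) ≤ lam n := by
      have : (2 : ℝ) ≤ n := by exact_mod_cast hn
      exact div_le_div_of_nonneg_left (by norm_num) (by linarith) (by linarith)
    rcases Nat.even_or_odd' s with ⟨c, rfl | rfl⟩
    · rw [show (2 * c + 1) / 2 = c by omega]
      push_cast at *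
      have h3 : 2 / (n : ℝ) * c ≤ lam n * c := mul_le_mul_of_nonneg_right hln (by positivity)
      have h4 : rat n (2 * c) - lam n * c ≤ 1 / n := by
        have : (2 * (c : ℝ) + 1) / n = 2 / n * c + 1 / n := by ring
        linarith
      have h5 : (rat n (2 * c) - lam n * c) * ((n : ℝ) - 2 * c + c) ≤ 1 / n * n := by
        have : (0 : ℝ) ≤ c := by positivity
        refine (mul_le_mul_of_nonneg_right h4 (by linarith)).trans ?_
        exact mul_le_mul_of_nonneg_left (by linarith) (by positivity)
      rw [one_div_mul_cancel hn0.ne'] at h5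
      linarith
    · rw [show (2 * c + 1 + 1) / 2 = c + 1 by omega]
      push_cast at *
      have h3 : 2 / (n : ℝ) * (c + 1) ≤ lam n * (c + 1) :=
        mul_le_mul_of_nonneg_right hln (by positivity)
      have h4 : rat n (2 * c + 1) - lam n * (c + 1) ≤ 0 := by
        have : (2 * (c : ℝ) + 1 + 1) / n = 2 / n * (c + 1) := by ring
        linarith
      have h5 : (rat n (2 * c + 1) - lam n * (c + 1)) * ((n : ℝ) - (2 * c + 1) + (c + 1)) ≤ 0 :=
        mul_nonpos_of_nonpos_of_nonneg h4 (by have : (0 : ℝ) ≤ c := by positivity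
                                              linarith)
      linarith
  have := partial_sum_nonpos _ ((s + 1) / 2) ?_ ?_ c (by omega) |> (hsum c).symm.trans_le
  · rw [hf] at this; linarith
  · intro i i' hii hi' hpos
    have h1 := mul_pos (zeros_pos hs i) hpos
    rw [hterm i (by omega)] at h1
    have h2 := pos_of_mul_pos_right h1 (base_nonneg i)
    refine nonneg_of_mul_nonneg_right (?_ : 0 ≤ ((n : ℝ) - s + i') * _) (zeros_pos hs i')
    rw [hterm i' (by omega)]
    refine mul_nonneg (base_nonneg i') ?_
    have hii' : (i : ℝ) < i' := by exact_mod_cast hii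
    refine nonneg_of_concave (A := -3 * lam n) hii'
      (by exact_mod_cast hi' : (i' : ℝ) ≤ ((s + 1) / 2 : ℕ)) (by linarith) h2.le htop ?_
    ring
  · rw [hsum, flowUp_top hs, hf]
    rcases Nat.even_or_odd' s with ⟨c, rfl | rfl⟩
    · rw [show (2 * c + 1) / 2 = c by omega]; simp
    · rw [show (2 * c + 1 + 1) / 2 = c + 1 by omega]
      have : typ n (2 * c + 1) (c + 1) = 0 := by rw [typ, if_neg (by omega)]
      simp [prb, this]

lemma flowStay_le_aux (hs : s < n) (hn : 20 ≤ n) (hs2 : 2 ≤ s) :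
    0 ≤ rat n s * ((s : ℝ) + 2 - 2 * (s / 2 : ℕ)) - (s / 2 : ℕ) -
      lam n * (((s : ℝ) + 1 - 2 * (s / 2 : ℕ)) * ((s : ℝ) + 2 - 2 * (s / 2 : ℕ))) +
      lam n * (((n : ℝ) - s + (s / 2 : ℕ) - 1) * (s / 2 : ℕ)) := by
  have hrl := rat_ge (n := n) (s := s) (by omega)
  have hl := lam_mul (n := n) (by omega)
  have hl0 := lam_pos (n := n) (by omega)
  have hn' : (20 : ℝ) ≤ n := by exact_mod_cast hn
  have hsn : (s : ℝ) + 1 ≤ n := by exact_mod_cast hs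
  have hn1 : (0 : ℝ) < n - 1 := by linarith
  rcases Nat.even_or_odd' s with ⟨c, rfl | rfl⟩
  · rw [show (2 * c) / 2 = c by omega]
    have hc : (1 : ℝ) ≤ c := by exact_mod_cast (by omega : 1 ≤ c)
    push_cast at *
    have h1 : lam n ≤ rat n (2 * c) := by
      refine le_trans ?_ hrl
      rw [lam, div_le_div_iff₀ hn1 (by linarith)]
      nlinarith
    have h2 : 1 ≤ lam n * ((n : ℝ) - 2 * c + c - 1) := by
      nlinarith
    nlinarith
  · rw [show (2 * c + 1) / 2 = c by omega]
    have hc : (1 : ℝ) ≤ c := by exact_mod_cast (by omega : 1 ≤ c)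
    push_cast at *
    have h0 : 0 ≤ 3 * (2 * (c : ℝ) + 1 + 1) * (n - 1) - 12 * (n + (2 * c + 1)) +
        c * (n - 2 * c - 3) * (n + (2 * c + 1)) := by
      have hcn : 2 * c + 2 ≤ n := by omega
      rcases hcn.lt_or_eq with h | h
      · rcases (by omega : 2 * c + 3 = n ∨ 2 * c + 4 ≤ n) with h | h
        · have : (n : ℝ) = 2 * c + 3 := by exact_mod_cast h.symm
          rw [this] at hn' ⊢
          nlinarith
        · have hh : 2 * (c : ℝ) + 4 ≤ n := by exact_mod_cast h
          rcases (by omega : c = 1 ∨ 2 ≤ c) with rfl | h2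
          · norm_num; nlinarith
          · have h2' : (2 : ℝ) ≤ c := by exact_mod_cast h2
            rcases le_or_gt 24 (2 * (c * ((n : ℝ) - 2 * c - 3))) with h3 | h3
            · nlinarith
            · have : 0 ≤ ((n : ℝ) - 2 * c - 4) * (c - 2) :=
                mul_nonneg (by linarith) (by linarith)
              nlinarith
      · have : (n : ℝ) = 2 * c + 2 := by exact_mod_cast h.symm
        rw [this] at hn' ⊢
        nlinarith
    have h1 : (2 * (c : ℝ) + 1 + 1) = (2 * (c : ℝ) + 1 + 1) / (n + (2 * c + 1)) * (n + (2 * c + 1)) := by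
      rw [div_mul_cancel₀]; linarith
    set q := (2 * (c : ℝ) + 1 + 1) / (n + (2 * c + 1)) with hq
    rw [h1] at h0
    have h3 : 0 ≤ (3 * q * (n - 1) - 12 + c * (n - 2 * c - 3)) * (n + (2 * (c : ℝ) + 1)) := by
      linarith
    have h4 := nonneg_of_mul_nonneg_left h3 (by linarith)
    refine nonneg_of_mul_nonneg_left (b := (n : ℝ) - 1) ?_ hn1
    have h5 := mul_le_mul_of_nonneg_right hrl hn1.le
    have h6 : (rat n (2 * c + 1) * (2 * (c : ℝ) + 1 + 2 - 2 * c) - c -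
      lam n * ((2 * (c : ℝ) + 1 + 1 - 2 * c) * (2 * (c : ℝ) + 1 + 2 - 2 * c)) +
      lam n * (((n : ℝ) - (2 * c + 1) + c - 1) * c)) * (n - 1) =
      3 * (rat n (2 * c + 1) * (n - 1)) - c * (n - 1) - 6 * (lam n * (n - 1)) +
      (lam n * (n - 1)) * ((n - c - 2) * c) := by ring
    rw [h6, hl]
    linarith

lemma flowStay_le (hs : s < n) (hn : 20 ≤ n) {c : ℕ} (hc : 2 * c ≤ s) :
    flowStay n s c ≤ lam n * (((n : ℝ) - s + c) * prb n s c) := by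
  have hl := lam_pos (n := n) (by omega)
  have hlm := lam_mul (n := n) (by omega)
  set f : ℕ → ℝ := fun i => ((n : ℝ) - s + i) * prb n s i with hf
  have hsum : ∀ m, ∑ i ∈ range (m + 1), ((prb n (s + 1) i - if i = 0 then 0 else prb n s (i - 1)) -
      lam n * (f i - if i = 0 then 0 else f (i - 1))) = flowStay n s m - lam n * f m := by
    intro m
    rw [sum_sub_distrib, ← mul_sum, sum_range_diff f m, ← flowStay_eq_sum]
  have hterm : ∀ i, 2 * i ≤ s + 1 → ((s : ℝ) + 2 - 2 * i) *
      ((prb n (s + 1) i - if i = 0 then 0 else prb n s (i - 1)) -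
      lam n * (f i - if i = 0 then 0 else f (i - 1))) = base n s i *
      (rat n s * ((s : ℝ) + 2 - 2 * i) - i -
        lam n * (((s : ℝ) + 1 - 2 * i) * ((s : ℝ) + 2 - 2 * i)) +
        lam n * (((n : ℝ) - s + i - 1) * i)) := by
    intro i hi
    have h1 := ones_mul_prb_pred' hs hi
    have h2 := zeros_mul_prb hs hi
    have h3 := stay_term hs hi
    rw [hf, mul_sub, h3]
    simp only
    rw [h2]
    cases i with
    | zero => simp; ring
    | succ i =>
      simp at h1 ⊢
      linear_combination lam n * ((n : ℝ) - s + i) * h1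
  have hfinal : flowStay n s (s / 2) - lam n * f (s / 2) ≤ 0 := by
    have h1 := flowUp_nonneg hs (c := s / 2) (by omega)
    have h2 : 1 ≤ lam n * ((n : ℝ) - s + (s / 2 : ℕ)) := by
      have : ((n : ℝ) - 1) ≤ 2 * ((n : ℝ) - s + (s / 2 : ℕ)) := by
        have : n + 2 * s ≤ 2 * n + 2 * (s / 2) + 1 := by omega
        have : (n : ℝ) + 2 * s ≤ 2 * n + 2 * (s / 2 : ℕ) + 1 := by exact_mod_cast this
        linarith
      nlinarith
    have h3 := mul_le_mul_of_nonneg_right h2 (prb_nonneg (n := n) (s := s) (s / 2))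
    rw [hf, flowStay]
    simp only
    linarith
  have := partial_sum_nonpos _ (s / 2) ?_ ?_ c (by omega) |> (hsum c).symm.trans_le
  · rw [hf] at this; linarith
  · intro i i' hii hi' hpos
    have h1 := mul_pos (ones_add_two_pos (s := s) (i := i) (by omega)) hpos
    rw [hterm i (by omega)] at h1
    have h2 := pos_of_mul_pos_right h1 (base_nonneg i)
    refine nonneg_of_mul_nonneg_right (?_ : 0 ≤ ((s : ℝ) + 2 - 2 * i') * _)
      (ones_add_two_pos (s := s) (by omega))
    rw [hterm i' (by omega)]
    refine mul_nonneg (base_nonneg i') ?_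
    have hii' : (i : ℝ) < i' := by exact_mod_cast hii
    refine nonneg_of_concave (A := -3 * lam n) hii'
      (by exact_mod_cast hi' : (i' : ℝ) ≤ (s / 2 : ℕ)) (by linarith) h2.le
      (flowStay_le_aux hs hn (by omega)) ?_
    ring
  · rw [hsum]; exact hfinal

/-- Transition weights: `A c` for raising a `0` and `B c` for raising a `1`, at an element of
rank `s` with `c` coordinates equal to `2`. -/
theorem exists_weights (hs : s < n) (hn : 20 ≤ n) : ∃ A B : ℕ → ℝ,
    (∀ c, 2 * c ≤ s → 0 ≤ A c ∧ A c ≤ lam n ∧ 0 ≤ B c ∧ B c ≤ lam n ∧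
      ((n : ℝ) - s + c) * A c + ((s : ℝ) - 2 * c) * B c = 1) ∧
    (∀ c, 2 * c ≤ s + 1 → ((s : ℝ) + 1 - 2 * c) * A c + c * B (c - 1) = rat n s) := by
  have hl := lam_pos (n := n) (by omega)
  have hprb : ∀ {c}, 2 * c ≤ s → 0 < prb n s c := fun {c} hc =>
    div_pos (by exact_mod_cast typ_pos n s c hs.le hc) (ell_pos' (by omega))
  have hbase : ∀ {c}, 2 * c ≤ s + 1 → 0 < base n s c := fun {c} hc =>
    div_pos (by exact_mod_cast typ_pos n (s + 1) c hs hc) (ell_pos' (by omega))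
  refine ⟨fun c => flowStay n s c / (((n : ℝ) - s + c) * prb n s c),
    fun c => flowUp n s c / (((s : ℝ) - 2 * c) * prb n s c), fun c hc => ?_, fun c hc => ?_⟩
  · have hp := hprb hc
    have ha := zeros_pos hs c
    have hb : (0 : ℝ) ≤ (s : ℝ) - 2 * c := by
      have : 2 * (c : ℝ) ≤ s := by exact_mod_cast hc
      linarith
    have hu0 := flowUp_nonneg hs (c := c) (by omega)
    have hu1 := flowUp_le hs (by omega) (c := c) (by omega)
    refine ⟨div_nonneg (flowStay_nonneg hs (by omega)) (by positivity),
      div_le_of_le_mul₀ (by positivity) hl.le (flowStay_le hs hn hc),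
      div_nonneg hu0 (by positivity), div_le_of_le_mul₀ (by positivity) hl.le hu1, ?_⟩
    rcases hb.eq_or_lt with hb | hb
    · rw [← hb, zero_mul, mul_zero] at hu1
      have : flowUp n s c = 0 := le_antisymm hu1 hu0
      simp only [flowStay, this, ← hb]; field_simp; simp
    · simp only [flowStay]
      rw [mul_div_assoc', mul_div_mul_left _ _ ha.ne', mul_div_assoc', mul_div_mul_left _ _ hb.ne',
        ← add_div, sub_add_cancel, div_self hp.ne']
  · have hr := rat_pos (n := n) (s := s) (by omega)
    have hbs := hbase hc
    have hst : ((s : ℝ) + 1 - 2 * c) * (flowStay n s c / (((n : ℝ) - s + c) * prb n s c)) =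
        flowStay n s c / base n s c := by
      rw [zeros_mul_prb hs hc]
      rcases hc.lt_or_eq with h | h
      · have : (0 : ℝ) < (s : ℝ) + 1 - 2 * c := by
          have : 2 * (c : ℝ) + 1 ≤ s + 1 := by exact_mod_cast h
          linarith
        field_simp
      · have h0 : ((s : ℝ) + 1 - 2 * c) = 0 := by
          have : 2 * (c : ℝ) = s + 1 := by exact_mod_cast h
          linarith
        have h1 : flowStay n s c = 0 := by
          have h2 := flowUp_top hs
          rw [show (s + 1) / 2 = c by omega] at h2
          have : typ n s c = 0 := by rw [typ, if_neg (by omega)]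
          rw [flowStay, h2, prb, this]; simp
        rw [h0, h1]; simp
    simp only
    rw [hst]
    cases c with
    | zero =>
      rw [flowStay_eq_sum]
      simp only [CharP.cast_eq_zero, zero_mul, add_zero]
      rw [div_eq_iff hbs.ne']
      simp [prb_succ_eq hs, mul_comm]
    | succ c =>
      simp only [Nat.add_sub_cancel]
      rw [ones_mul_prb_pred hs hc]
      have h1 : flowStay n s (c + 1) + flowUp n s c = base n s (c + 1) * rat n s := by
        rw [← prb_succ_eq hs, flowStay, flowUp, flowUp, sum_range_succ _ (c + 1)]; ring
      have hc0 : (0 : ℝ) < (c : ℝ) + 1 := by positivity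
      push_cast
      field_simp
      linarith

end flow
/-- Number of coordinates equal to `v`. -/
def cnt {n : ℕ} (v : Fin 3) (x : Fin n → Fin 3) : ℕ := #(univ.filter fun j => x j = v)

lemma cnt_add {n : ℕ} (x : Fin n → Fin 3) : cnt 0 x + cnt 1 x + cnt 2 x = n := by
  simp only [cnt, card_filter, ← sum_add_distrib]
  have : ∀ v : Fin 3, ((if v = 0 then 1 else 0) + (if v = 1 then 1 else 0) +
      (if v = 2 then 1 else 0) : ℕ) = 1 := by decide
  simp [this]

lemma cnt_rk {n : ℕ} (x : Fin n → Fin 3) : cnt 1 x + 2 * cnt 2 x = rk x := by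
  simp only [cnt, card_filter, rk, mul_sum, ← sum_add_distrib]
  have : ∀ v : Fin 3, ((if v = 1 then 1 else 0) + 2 * (if v = 2 then 1 else 0) : ℕ) = v := by
    decide
  exact sum_congr rfl fun j _ => this (x j)

/-- Raise coordinate `j` by one. -/
def up {n : ℕ} (x : Fin n → Fin 3) (j : Fin n) : Fin n → Fin 3 := Function.update x j (x j + 1)

/-- Lower coordinate `j` by one. -/
def dn {n : ℕ} (x : Fin n → Fin 3) (j : Fin n) : Fin n → Fin 3 := Function.update x j (x j - 1)

lemma dn_up {n : ℕ} (x : Fin n → Fin 3) (j : Fin n) : dn (up x j) j = x := by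
  simp [dn, up]

lemma up_dn {n : ℕ} (x : Fin n → Fin 3) (j : Fin n) : up (dn x j) j = x := by
  simp [dn, up]

/-- `y` arises from `x` by raising one coordinate. -/
def Cov {n : ℕ} (x y : Fin n → Fin 3) : Prop := ∃ j, x j ≠ 2 ∧ y = up x j

lemma rk_up {n : ℕ} (x : Fin n → Fin 3) (j : Fin n) (hj : x j ≠ 2) : rk (up x j) = rk x + 1 := by
  have h : ∀ v : Fin 3, v ≠ 2 → ((v + 1 : Fin 3) : ℕ) = v + 1 := by decide
  rw [rk, rk, ← add_sum_erase _ _ (mem_univ j), ← add_sum_erase (a := j) univ (fun i => (x i : ℕ)) (mem_univ j)]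
  rw [sum_congr rfl (g := fun i => (x i : ℕ))]
  · simp [up, h _ hj]; ring
  · intro i hi
    simp [up, Function.update_of_ne (ne_of_mem_erase hi)]

lemma up_inj {n : ℕ} {x : Fin n → Fin 3} {i j : Fin n} (h : up x i = up x j) : i = j := by
  by_contra hij
  have h1 := congrFun h i
  have h2 : ∀ v : Fin 3, v + 1 ≠ v := by decide
  simp [up, Function.update_of_ne hij] at h1

lemma Cov.rk_eq {n : ℕ} {x y : Fin n → Fin 3} (h : Cov x y) : rk y = rk x + 1 := by
  obtain ⟨j, hj, rfl⟩ := h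
  exact rk_up x j hj

lemma Cov.le {n : ℕ} {x y : Fin n → Fin 3} (h : Cov x y) : x ≤ y := by
  obtain ⟨j, hj, rfl⟩ := h
  have h : ∀ v : Fin 3, v ≠ 2 → v ≤ v + 1 := by decide
  intro i
  by_cases hi : i = j
  · subst hi; simpa [up] using h _ hj
  · simp [up, Function.update_of_ne hi]

lemma Cov.mir {n : ℕ} {x y : Fin n → Fin 3} (h : Cov x y) : Cov (mir y) (mir x) := by
  obtain ⟨j, hj, rfl⟩ := h
  have h1 : ∀ v : Fin 3, v ≠ 2 → (v + 1).rev ≠ 2 := by decide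
  have h2 : ∀ v : Fin 3, v.rev = (v + 1).rev + 1 := by decide
  refine ⟨j, by simpa [MultisetSupersaturation.mir, up] using h1 _ hj, ?_⟩
  funext i
  by_cases hi : i = j
  · subst hi; simp [up, MultisetSupersaturation.mir, ← h2]
  · simp [up, MultisetSupersaturation.mir, Function.update_of_ne hi]

section matrix
variable {n : ℕ} (A B : ℕ → ℕ → ℝ)

/-- Weight for raising coordinate `j` of `x`. -/
noncomputable def stepW (x : Fin n → Fin 3) (j : Fin n) : ℝ :=
  if x j = 0 then A (rk x) (cnt 2 x) else if x j = 1 then B (rk x) (cnt 2 x) else 0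

open Classical in
/-- Transition weights between consecutive levels. -/
noncomputable def stepM (x y : Fin n → Fin 3) : ℝ :=
  ∑ j, if x j ≠ 2 ∧ y = up x j then stepW A B x j else 0

lemma stepM_supp {x y : Fin n → Fin 3} (h : stepM A B x y ≠ 0) : Cov x y := by
  obtain ⟨j, _, hj⟩ := exists_ne_zero_of_sum_ne_zero h
  by_cases hc : x j ≠ 2 ∧ y = up x j
  · exact ⟨j, hc⟩
  · simp [hc] at hj

lemma stepM_up {x : Fin n → Fin 3} {j : Fin n} (hj : x j ≠ 2) :
    stepM A B x (up x j) = stepW A B x j := by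
  rw [stepM, sum_eq_single j]
  · simp [hj]
  · intro i _ hi
    rw [if_neg]
    rintro ⟨-, h⟩
    exact hi (up_inj h).symm
  · simp

lemma stepM_row (x : Fin n → Fin 3) : ∑ y, stepM A B x y =
    cnt 0 x * A (rk x) (cnt 2 x) + cnt 1 x * B (rk x) (cnt 2 x) := by
  simp only [stepM]
  rw [sum_comm]
  have h : ∀ j, (∑ y, if x j ≠ 2 ∧ y = up x j then stepW A B x j else 0) =
      (if x j = 0 then 1 else 0) * A (rk x) (cnt 2 x) +
        (if x j = 1 then 1 else 0) * B (rk x) (cnt 2 x) := by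
    intro j
    simp only [ite_and, stepW]
    generalize x j = v
    fin_cases v <;> simp
  rw [sum_congr rfl fun j _ => h j, sum_add_distrib, ← sum_mul, ← sum_mul,
    sum_boole, sum_boole]
  rfl

lemma cnt_two_dn_one {y : Fin n → Fin 3} {j : Fin n} (h : y j = 1) : cnt 2 (dn y j) = cnt 2 y := by
  rw [cnt, cnt]
  congr 1
  ext i
  by_cases hi : i = j
  · subst hi; simp [dn, h]
  · have e : dn y j i = y i := Function.update_of_ne hi _ _
    simp [e]

lemma cnt_two_dn_two {y : Fin n → Fin 3} {j : Fin n} (h : y j = 2) :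
    cnt 2 (dn y j) = cnt 2 y - 1 := by
  rw [cnt, cnt, ← card_erase_of_mem (a := j) (by simp [h])]
  congr 1
  ext i
  by_cases hi : i = j
  · subst hi; simp [dn, h]
  · have e : dn y j i = y i := Function.update_of_ne hi _ _
    simp [e, hi]

lemma rk_dn {y : Fin n → Fin 3} {j : Fin n} (h : y j ≠ 0) : rk (dn y j) = rk y - 1 := by
  have h1 : ∀ v : Fin 3, v ≠ 0 → v - 1 ≠ 2 := by decide
  have := rk_up (dn y j) j (by simpa [dn] using h1 _ h)
  rw [up_dn] at this; omega

lemma stepM_col (y : Fin n → Fin 3) : ∑ x, stepM A B x y =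
    cnt 1 y * A (rk y - 1) (cnt 2 y) + cnt 2 y * B (rk y - 1) (cnt 2 y - 1) := by
  simp only [stepM]
  rw [sum_comm]
  have h : ∀ j, (∑ x, if x j ≠ 2 ∧ y = up x j then stepW A B x j else 0) =
      (if y j = 1 then 1 else 0) * A (rk y - 1) (cnt 2 y) +
        (if y j = 2 then 1 else 0) * B (rk y - 1) (cnt 2 y - 1) := by
    intro j
    have h1 : ∀ x : Fin n → Fin 3, (x j ≠ 2 ∧ y = up x j) ↔ (y j ≠ 0 ∧ x = dn y j) := by
      intro x
      constructor
      · rintro ⟨a, rfl⟩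
        have : ∀ v : Fin 3, v ≠ 2 → v + 1 ≠ 0 := by decide
        exact ⟨by simpa [up] using this _ a, (dn_up x j).symm⟩
      · rintro ⟨a, rfl⟩
        have : ∀ v : Fin 3, v ≠ 0 → v - 1 ≠ 2 := by decide
        exact ⟨by simpa [dn] using this _ a, (up_dn y j).symm⟩
    simp only [h1, ite_and]
    have h3 : ∀ v : Fin 3, v = 0 ∨ v = 1 ∨ v = 2 := by decide
    rcases h3 (y j) with h | h | h
    · simp [h]
    · have e : dn y j j = 0 := by simp [dn, h]
      simp [h, stepW, e, cnt_two_dn_one h, rk_dn (y := y) (j := j) (by simp [h])]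
    · have e : dn y j j = 1 := by simp [dn, h]
      simp [h, stepW, e, cnt_two_dn_two h, rk_dn (y := y) (j := j) (by simp [h])]
  rw [sum_congr rfl fun j _ => h j, sum_add_distrib, ← sum_mul, ← sum_mul,
    sum_boole, sum_boole]
  rfl

end matrix

lemma Cov.of_mir {n : ℕ} {x y : Fin n → Fin 3} (h : Cov (MultisetSupersaturation.mir y) (MultisetSupersaturation.mir x)) : Cov x y := by
  simpa [mir_mir] using h.mir

lemma sum_mir {n : ℕ} (f : (Fin n → Fin 3) → ℝ) : ∑ x, f (mir x) = ∑ x, f x :=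
  (Function.Involutive.bijective mir_mir).sum_comp f

/-- A Markov chain on `{0,1,2}^n` moving up one level at a time, preserving the uniform
distributions on levels, compatible with complementation and with transition probabilities at
most `lam n` in the lower half. -/
structure LevelChain (n : ℕ) (U : Matrix (Fin n → Fin 3) (Fin n → Fin 3) ℝ) : Prop where
  nonneg : ∀ x y, 0 ≤ U x y
  supp : ∀ x y, U x y ≠ 0 → Cov x y
  row : ∀ x, rk x < 2 * n → ∑ y, U x y = 1
  col : ∀ y, 1 ≤ rk y → ∑ x, U x y = rat n (rk y - 1)
  symm : ∀ x y, U x y * ell n (rk y) = U (mir y) (mir x) * ell n (rk x)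
  low : ∀ x y, rk x < n → U x y ≤ lam n

theorem exists_levelChain (n : ℕ) (hn : 20 ≤ n) : ∃ U, LevelChain n U := by
  have hex : ∀ s, ∃ A B : ℕ → ℝ, s < n → (∀ c, 2 * c ≤ s → 0 ≤ A c ∧ A c ≤ lam n ∧
      0 ≤ B c ∧ B c ≤ lam n ∧ ((n : ℝ) - s + c) * A c + ((s : ℝ) - 2 * c) * B c = 1) ∧
      (∀ c, 2 * c ≤ s + 1 → ((s : ℝ) + 1 - 2 * c) * A c + c * B (c - 1) = rat n s) := by
    intro s
    by_cases hs : s < n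
    · obtain ⟨A, B, h⟩ := exists_weights hs hn
      exact ⟨A, B, fun _ => h⟩
    · exact ⟨0, 0, fun h => absurd h hs⟩
  choose A B hAB using hex
  have hl := (lam_pos (n := n) (by omega)).le
  set M := stepM (n := n) A B with hM
  have hWb : ∀ x : Fin n → Fin 3, rk x < n → ∀ j, 0 ≤ stepW A B x j ∧ stepW A B x j ≤ lam n := by
    intro x hx j
    have h1 := cnt_rk x
    obtain ⟨a, b, c, d, -⟩ := (hAB (rk x) hx).1 (cnt 2 x) (by omega)
    rw [stepW]
    split_ifs <;> simp [*]
  have hMsupp : ∀ x y, ¬ Cov x y → M x y = 0 := by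
    intro x y h
    by_contra h'
    exact h (stepM_supp A B h')
  have hMb : ∀ x y, rk x < n → 0 ≤ M x y ∧ M x y ≤ lam n := by
    intro x y hx
    by_cases h : Cov x y
    · obtain ⟨j, hj, rfl⟩ := h
      rw [hM, stepM_up A B hj]; exact hWb x hx j
    · rw [hMsupp x y h]; exact ⟨le_rfl, hl⟩
  have hMrow : ∀ x, rk x < n → ∑ y, M x y = 1 := by
    intro x hx
    rw [hM, stepM_row]
    have h1 := cnt_rk x
    have h2 := cnt_add x
    obtain ⟨-, -, -, -, h⟩ := (hAB (rk x) hx).1 (cnt 2 x) (by omega)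
    rw [← h]
    have h1' : (cnt 1 x : ℝ) + 2 * cnt 2 x = rk x := by exact_mod_cast h1
    have h2' : (cnt 0 x : ℝ) + cnt 1 x + cnt 2 x = n := by exact_mod_cast h2
    rw [← h1', ← h2']; ring
  have hMcol : ∀ y, 1 ≤ rk y → rk y ≤ n → ∑ x, M x y = rat n (rk y - 1) := by
    intro y hy hy'
    rw [hM, stepM_col]
    have h1 := cnt_rk y
    have h := (hAB (rk y - 1) (by omega)).2 (cnt 2 y) (by omega)
    rw [← h]
    have h1' : (cnt 1 y : ℝ) + 2 * cnt 2 y = (rk y - 1 : ℕ) + 1 := by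
      exact_mod_cast (by omega : cnt 1 y + 2 * cnt 2 y = rk y - 1 + 1)
    rw [← h1']; ring
  have hmr := fun x : Fin n → Fin 3 => rk_mir_add x
  have hep : ∀ x : Fin n → Fin 3, (0 : ℝ) < ell n (rk x) := fun x => ell_pos' (rk_le x)
  have hes : ∀ x : Fin n → Fin 3, ell n (rk (mir x)) = ell n (rk x) := fun x => by
    rw [ell_symm n _ (rk_le x)]; congr 1; have := hmr x; omega
  refine ⟨fun x y => if rk x < n then M x y else
    M (mir y) (mir x) * (ell n (rk x) / ell n (rk y)), ?_, ?_, ?_, ?_, ?_, ?_⟩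
  · intro x y
    by_cases hx : rk x < n
    · simp only [hx, if_true]; exact (hMb x y hx).1
    · simp only [hx, if_false]
      by_cases h : Cov (mir y) (mir x)
      · have := h.rk_eq
        have := hmr x
        exact mul_nonneg (hMb _ _ (by omega)).1 (div_nonneg (hep x).le (hep y).le)
      · rw [hMsupp _ _ h]; simp
  · intro x y
    by_cases hx : rk x < n
    · simp only [hx, if_true]; exact stepM_supp A B
    · simp only [hx, if_false]
      intro h
      exact (stepM_supp A B (left_ne_zero_of_mul h)).of_mir
  · intro x hx2
    by_cases hx : rk x < n
    · simp only [hx, if_true]; exact hMrow x hx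
    · simp only [hx, if_false]
      have e : ∀ y, M (mir y) (mir x) * ((ell n (rk x) : ℝ) / ell n (rk y)) =
          M (mir y) (mir x) * ((ell n (rk x) : ℝ) / ell n (rk x + 1)) := by
        intro y
        by_cases h : Cov (mir y) (mir x)
        · rw [h.of_mir.rk_eq]
        · rw [hMsupp _ _ h]; simp
      simp only [e]
      have := hmr x
      rw [← sum_mul, sum_mir (fun z => M z (mir x)), hMcol _ (by omega) (by omega), rat]
      have e1 : ell n (rk (mir x) - 1) = ell n (rk x + 1) := by
        rw [ell_symm n (rk x + 1) (by omega)]; congr 1; omega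
      rw [Nat.sub_add_cancel (by omega), hes, e1]
      have h1 := hep x
      have h2 := ell_pos' (n := n) (i := rk x + 1) (by omega)
      field_simp
  · intro y hy
    by_cases hy' : rk y ≤ n
    · rw [← hMcol y hy hy']
      refine sum_congr rfl fun x _ => ?_
      by_cases h : Cov x y
      · have := h.rk_eq
        rw [if_pos (by omega)]
      · rw [hMsupp _ _ h, hMsupp (mir y) (mir x) (fun h' => h h'.of_mir)]; simp
    · have e : ∀ x, (if rk x < n then M x y else
          M (mir y) (mir x) * ((ell n (rk x) : ℝ) / ell n (rk y))) =
          M (mir y) (mir x) * ((ell n (rk y - 1) : ℝ) / ell n (rk y)) := by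
        intro x
        by_cases h : Cov x y
        · have := h.rk_eq
          rw [if_neg (by omega), this, Nat.add_sub_cancel]
        · rw [hMsupp _ _ h, hMsupp (mir y) (mir x) (fun h' => h h'.of_mir)]; simp
      have := hmr y
      simp only [e]
      rw [← sum_mul, sum_mir (fun z => M (mir y) z), hMrow _ (by omega), rat, Nat.sub_add_cancel hy,
        one_mul]
  · intro x y
    by_cases h : Cov x y
    · have h1 := h.rk_eq
      have h2 := hmr y
      have h3 := hmr x
      have hx := hep x
      have hy := hep y
      by_cases hx : rk x < n
      · simp only [hx, if_true]
        rw [if_neg (by omega), mir_mir, mir_mir, hes, hes]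
        field_simp
      · simp only [hx, if_false]
        rw [if_pos (by omega)]
        field_simp
    · rw [hMsupp _ _ h, hMsupp (mir y) (mir x) (fun h' => h h'.of_mir), mir_mir, mir_mir,
        hMsupp _ _ h]
      simp
  · intro x y hx
    simp only [hx, if_true]; exact (hMb x y hx).2

namespace LevelChain

variable {n : ℕ} {U : Matrix (Fin n → Fin 3) (Fin n → Fin 3) ℝ}

lemma pow_nonneg (hU : LevelChain n U) (d : ℕ) (x y : Fin n → Fin 3) : 0 ≤ (U ^ d) x y := by
  induction d generalizing y with
  | zero => rw [pow_zero, Matrix.one_apply]; split_ifs <;> simp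
  | succ d ih =>
    rw [pow_succ, Matrix.mul_apply]
    exact sum_nonneg fun z _ => mul_nonneg (ih z) (hU.nonneg z y)

lemma pow_supp (hU : LevelChain n U) {d : ℕ} {x y : Fin n → Fin 3} (h : (U ^ d) x y ≠ 0) :
    x ≤ y ∧ rk y = rk x + d := by
  induction d generalizing y with
  | zero =>
    rw [pow_zero, Matrix.one_apply] at h
    have : x = y := by by_contra h'; simp [h'] at h
    subst this; simp
  | succ d ih =>
    rw [pow_succ, Matrix.mul_apply] at h
    obtain ⟨z, -, hz⟩ := exists_ne_zero_of_sum_ne_zero h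
    have h1 := ih (left_ne_zero_of_mul hz)
    have h2 := hU.supp z y (right_ne_zero_of_mul hz)
    exact ⟨h1.1.trans h2.le, by rw [h2.rk_eq, h1.2]; ring⟩

lemma pow_symm (hU : LevelChain n U) (d : ℕ) (x y : Fin n → Fin 3) :
    (U ^ d) x y * ell n (rk y) = (U ^ d) (mir y) (mir x) * ell n (rk x) := by
  induction d generalizing y with
  | zero =>
    by_cases h : x = y
    · subst h; simp
    · have h' : mir y ≠ mir x := fun e => h (by rw [← mir_mir x, ← e, mir_mir])
      simp [h, h']
  | succ d ih =>
    conv_rhs => rw [pow_succ', Matrix.mul_apply, ← sum_mir, sum_mul]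
    rw [pow_succ, Matrix.mul_apply, sum_mul]
    refine sum_congr rfl fun z _ => ?_
    rw [mul_assoc, hU.symm, ← mul_assoc, mul_right_comm, ih]; ring

lemma row_le (hU : LevelChain n U) (x : Fin n → Fin 3) : ∑ y, U x y ≤ 1 := by
  by_cases h : rk x < 2 * n
  · exact (hU.row x h).le
  · rw [sum_eq_zero]
    · simp
    · intro y _
      by_contra h'
      have := (hU.supp x y h').rk_eq
      have := rk_le y
      omega

lemma pow_row_le (hU : LevelChain n U) (d : ℕ) (x : Fin n → Fin 3) : ∑ y, (U ^ d) x y ≤ 1 := by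
  induction d with
  | zero => simp [Matrix.one_apply]
  | succ d ih =>
    simp only [pow_succ, Matrix.mul_apply]
    rw [sum_comm]
    refine (sum_le_sum fun z _ => ?_).trans ih
    rw [← mul_sum]
    exact mul_le_of_le_one_right (hU.pow_nonneg d x z) (hU.row_le z)

end LevelChain

open Classical in
lemma card_between {n : ℕ} {x z : Fin n → Fin 3} (hxz : x ≤ z) :
    #(univ.filter fun w => x ≤ w ∧ Cov w z) + rk x ≤ rk z := by
  have h1 : (univ.filter fun w => x ≤ w ∧ Cov w z) ⊆
      (univ.filter fun j => x j < z j).image (dn z) := by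
    intro w hw
    simp only [mem_filter, mem_univ, true_and, mem_image] at hw ⊢
    obtain ⟨hxw, j, hj, rfl⟩ := hw
    have h : ∀ v : Fin 3, v ≠ 2 → v < v + 1 := by decide
    exact ⟨j, (hxw j).trans_lt (by simpa [up] using h _ hj), dn_up w j⟩
  have h2 := (card_le_card h1).trans card_image_le
  refine (Nat.add_le_add_right h2 _).trans ?_
  rw [card_filter, rk, rk, ← sum_add_distrib]
  refine sum_le_sum fun j _ => ?_
  have := hxz j
  split_ifs with h
  · have : (x j : ℕ) < z j := h
    omega
  · have : (x j : ℕ) ≤ z j := this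
    omega

namespace LevelChain

variable {n : ℕ} {U : Matrix (Fin n → Fin 3) (Fin n → Fin 3) ℝ}

/-- Bound on multi-step transition probabilities by counting paths. -/
lemma pow_le (hU : LevelChain n U) {c : ℕ → ℝ} (hc : ∀ s, 0 ≤ c s) {R : ℕ}
    (hb : ∀ u v, rk u < R → U u v ≤ c (rk u)) (d : ℕ) (x z : Fin n → Fin 3) (hR : rk x + d ≤ R) :
    (U ^ d) x z ≤ d.factorial * ∏ i ∈ range d, c (rk x + i) := by
  classical
  induction d generalizing z with
  | zero => rw [pow_zero, Matrix.one_apply]; split_ifs <;> simp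
  | succ d ih =>
    set Q := (d.factorial : ℝ) * ∏ i ∈ range d, c (rk x + i) with hQ
    have hQ0 : 0 ≤ Q := mul_nonneg (by positivity) (prod_nonneg fun i _ => hc _)
    have hne : 0 ≤ (((d + 1).factorial : ℕ) : ℝ) * ∏ i ∈ range (d + 1), c (rk x + i) :=
      mul_nonneg (by positivity) (prod_nonneg fun i _ => hc _)
    by_cases hne0 : (U ^ (d + 1)) x z = 0
    · rw [hne0]; exact hne
    obtain ⟨hxz, hrk⟩ := hU.pow_supp hne0
    rw [pow_succ, Matrix.mul_apply,
      ← sum_subset (subset_univ (univ.filter fun w => x ≤ w ∧ Cov w z))]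
    · have h1 : ∀ w ∈ univ.filter (fun w => x ≤ w ∧ Cov w z),
          (U ^ d) x w * U w z ≤ Q * c (rk x + d) := by
        intro w hw
        simp only [mem_filter, mem_univ, true_and] at hw
        have hw2 := hw.2.rk_eq
        have e : rk w = rk x + d := by omega
        have := hb w z (by omega)
        rw [e] at this
        exact mul_le_mul (ih w (by omega)) this (hU.nonneg _ _) hQ0
      refine (sum_le_card_nsmul _ _ _ h1).trans ?_
      have h2 := card_between hxz
      have h3 : (#(univ.filter fun w => x ≤ w ∧ Cov w z) : ℝ) ≤ d + 1 := by
        exact_mod_cast (by omega : #(univ.filter fun w => x ≤ w ∧ Cov w z) ≤ d + 1)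
      rw [nsmul_eq_mul]
      refine (mul_le_mul_of_nonneg_right h3 (mul_nonneg hQ0 (hc _))).trans_eq ?_
      rw [prod_range_succ, Nat.factorial_succ, hQ]
      push_cast; ring
    · intro w _ hw
      by_contra hne
      exact hw (by simpa using ⟨(hU.pow_supp (left_ne_zero_of_mul hne)).1,
        hU.supp _ _ (right_ne_zero_of_mul hne)⟩)

lemma high (hU : LevelChain n U) (hn : 2 ≤ n) (x y : Fin n → Fin 3) (hx : n ≤ rk x)
    (hx2 : rk x < 2 * n) : U x y ≤ lam n * (1 + ((n : ℝ) - 1) / ((2 * n : ℝ) - rk x)) := by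
  have hl := lam_pos hn
  have hx' : ((rk x : ℕ) : ℝ) + 1 ≤ 2 * n := by exact_mod_cast hx2
  have hn' : (2 : ℝ) ≤ n := by exact_mod_cast hn
  have hd : (0 : ℝ) < (2 * n : ℝ) - rk x := by linarith
  by_cases h : U x y = 0
  · rw [h]; exact mul_nonneg hl.le (add_nonneg zero_le_one (div_nonneg (by linarith) hd.le))
  have h1 := (hU.supp x y h).rk_eq
  have h2 := hU.symm x y
  have h3 := hU.low (mir y) (mir x) (by have := rk_mir_add y; omega)
  have h4 := mul_ell_ge n (2 * n - rk x - 1)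
  rw [Nat.sub_add_cancel (by omega), ← ell_symm n _ (rk_le x),
    show 2 * n - rk x - 1 = 2 * n - rk y by omega, ← ell_symm n _ (rk_le y)] at h4
  have h5 : ((2 * n : ℝ) - rk x) * ell n (rk x) ≤ (3 * n - rk x - 1) * ell n (rk y) := by
    have e1 : ((2 * n - rk x : ℕ) : ℝ) = 2 * n - rk x := by
      rw [Nat.cast_sub (rk_le x)]; push_cast; ring
    have e2 : ((n + (2 * n - rk y) : ℕ) : ℝ) = 3 * n - rk x - 1 := by
      rw [Nat.cast_add, Nat.cast_sub (rk_le y), h1]; push_cast; ring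
    rw [← e1, ← e2]; exact_mod_cast h4
  have hy := ell_pos' (rk_le y)
  have hxp := ell_pos' (rk_le x)
  rw [show 1 + ((n : ℝ) - 1) / ((2 * n : ℝ) - rk x) =
    (3 * n - rk x - 1) / ((2 * n : ℝ) - rk x) by
      rw [eq_div_iff hd.ne', add_mul, div_mul_cancel₀ _ hd.ne']; ring, mul_div_assoc', le_div_iff₀ hd]
  refine le_of_mul_le_mul_right ?_ hy
  calc U x y * (2 * n - rk x) * ell n (rk y)
      = U (mir y) (mir x) * ((2 * n - rk x) * ell n (rk x)) := by
        rw [mul_right_comm, h2]; ring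
    _ ≤ lam n * ((3 * n - rk x - 1) * ell n (rk y)) :=
        mul_le_mul h3 h5 (mul_nonneg hd.le hxp.le) hl.le
    _ = _ := by ring

lemma pow_le_near (hU : LevelChain n U) (hn : 2 ≤ n) {k : ℕ} (hk : 1 ≤ k) (hnk : 11 * k ≤ n)
    (x y : Fin n → Fin 3) (hx : rk x < n) :
    (U ^ k) x y ≤ k.factorial * (lam n * (2.1 * lam n) ^ (k - 1)) := by
  have hl := lam_pos hn
  have h := hU.pow_le (c := fun s => if s < n then lam n else 2.1 * lam n) (R := rk x + k)
    (fun s => by split_ifs <;> positivity) ?_ k x y le_rfl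
  · refine h.trans (mul_le_mul_of_nonneg_left ?_ (by positivity))
    obtain ⟨j, rfl⟩ : ∃ j, k = j + 1 := ⟨k - 1, by omega⟩
    rw [prod_range_succ', mul_comm, Nat.add_sub_cancel, add_zero, if_pos hx]
    refine mul_le_mul_of_nonneg_left ?_ hl.le
    rw [← card_range j, ← prod_const, card_range]
    refine prod_le_prod (fun i _ => by split_ifs <;> positivity) fun i _ => ?_
    split_ifs
    · linarith
    · exact le_rfl
  · intro u v hu
    split_ifs with h1
    · exact hU.low u v h1
    · refine (hU.high hn u v (by omega) (by omega)).trans ?_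
      rw [mul_comm (2.1 : ℝ)]
      refine mul_le_mul_of_nonneg_left ?_ hl.le
      have h2 : ((rk u : ℕ) : ℝ) + 2 ≤ n + k := by exact_mod_cast (by omega : rk u + 2 ≤ n + k)
      have h3 : 11 * (k : ℝ) ≤ n := by exact_mod_cast hnk
      have hn' : (2 : ℝ) ≤ n := by exact_mod_cast hn
      have : ((n : ℝ) - 1) / ((2 * n : ℝ) - rk u) ≤ 1.1 := by
        rw [div_le_iff₀ (by linarith)]; linarith
      linarith

lemma pow_le_far (hU : LevelChain n U) (hn : 2 ≤ n) (k d : ℕ) (hd : k ≤ d)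
    (x y : Fin n → Fin 3) (hy : rk y + n / 4 ≤ 2 * n) :
    (U ^ d) x y ≤ k.factorial * (5 * lam n) ^ k := by
  have hl := lam_pos hn
  have hb : ∀ u v, rk u < rk y → U u v ≤ 5 * lam n := by
    intro u v hu
    by_cases h1 : rk u < n
    · exact (hU.low u v h1).trans (by linarith)
    · refine (hU.high hn u v (by omega) (by omega)).trans ?_
      rw [mul_comm (5 : ℝ)]
      refine mul_le_mul_of_nonneg_left ?_ hl.le
      have h2 : 4 * ((rk u : ℕ) : ℝ) + n + 1 ≤ 8 * n := by
        exact_mod_cast (by omega : 4 * rk u + n + 1 ≤ 8 * n)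
      have hn' : (2 : ℝ) ≤ n := by exact_mod_cast hn
      have : ((n : ℝ) - 1) / ((2 * n : ℝ) - rk u) ≤ 4 := by
        rw [div_le_iff₀ (by linarith)]; linarith
      linarith
  set Q := (k.factorial : ℝ) * (5 * lam n) ^ k
  have hQ : 0 ≤ Q := by positivity
  have hk : ∀ z, (U ^ k) z y ≤ Q := by
    intro z
    by_cases h : (U ^ k) z y = 0
    · rw [h]; exact hQ
    · have h1 := (hU.pow_supp h).2
      have := hU.pow_le (c := fun _ => 5 * lam n) (fun _ => by positivity) hb k z y h1.ge
      simpa using this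
  rw [← Nat.sub_add_cancel hd, pow_add, Matrix.mul_apply]
  calc ∑ z, (U ^ (d - k)) x z * (U ^ k) z y ≤ ∑ z, (U ^ (d - k)) x z * Q :=
        sum_le_sum fun z _ => mul_le_mul_of_nonneg_left (hk z) (hU.pow_nonneg _ _ _)
    _ = (∑ z, (U ^ (d - k)) x z) * Q := by rw [sum_mul]
    _ ≤ Q := mul_le_of_le_one_left hQ (hU.pow_row_le _ _)

/-- The key bound on joint probabilities of pairs of elements on a random chain. -/
lemma joint_le (hU : LevelChain n U) (hn : 2 ≤ n) {k : ℕ} (hk : 1 ≤ k) (hnk : 11 * k ≤ n) {e : ℝ}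
    (h1 : k.factorial * (lam n * (2.1 * lam n) ^ (k - 1)) ≤ e)
    (h2 : (k + 1).factorial * (5 * lam n) ^ (k + 1) ≤ e) (x y : Fin n → Fin 3) {d : ℕ} (hd : k ≤ d)
    (hxy : ¬ (rk x < n / 4 ∧ 2 * n < rk y + n / 4)) (hrk : rk y = rk x + d) :
    min (ell n (rk x) : ℝ) (ell n (rk y)) * ((U ^ d) x y / ell n (rk x)) ≤ e := by
  have hx := ell_pos' (rk_le x)
  have hp := hU.pow_nonneg d x y
  have hmx := rk_mir_add x
  have hmy := rk_mir_add y
  have hA : min (ell n (rk x) : ℝ) (ell n (rk y)) * ((U ^ d) x y / ell n (rk x)) ≤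
      (U ^ d) x y := by
    refine (mul_le_mul_of_nonneg_right (min_le_left _ _) (by positivity)).trans_eq ?_
    field_simp
  have hB : min (ell n (rk x) : ℝ) (ell n (rk y)) * ((U ^ d) x y / ell n (rk x)) ≤
      (U ^ d) (mir y) (mir x) := by
    refine (mul_le_mul_of_nonneg_right (min_le_right _ _) (by positivity)).trans_eq ?_
    rw [mul_div_assoc', mul_comm, hU.pow_symm]
    field_simp
  rcases hd.eq_or_lt with rfl | hd
  · by_cases h : rk x < n
    · exact hA.trans ((hU.pow_le_near hn hk hnk x y h).trans h1)
    · exact hB.trans ((hU.pow_le_near hn hk hnk _ _ (by omega)).trans h1)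
  · by_cases h : rk y + n / 4 ≤ 2 * n
    · exact hA.trans ((hU.pow_le_far hn (k + 1) d hd x y h).trans h2)
    · exact hB.trans ((hU.pow_le_far hn (k + 1) d hd _ _ (by omega)).trans h2)

/-- Uniform starting point on level `i`, followed by the chain. -/
lemma exists_paths (hU : LevelChain n U) (m : ℕ) (hm : m ≤ 2 * n) :
    ∃ (Ω : Type) (_ : Fintype Ω) (w : Ω → ℝ) (p : Ω → ℕ → Fin n → Fin 3), (∀ a, 0 ≤ w a) ∧
      (∀ a i, w a ≠ 0 → i ≤ m → rk (p a i) = i) ∧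
      ∀ i j, i ≤ j → j ≤ m → ∀ F : (Fin n → Fin 3) → (Fin n → Fin 3) → ℝ,
        ∑ a, w a * F (p a i) (p a j) =
          ∑ x with rk x = i, ∑ y, (U ^ (j - i)) x y / ell n i * F x y := by
  induction m with
  | zero =>
    have h0 : ∀ x : Fin n → Fin 3, rk x = 0 ↔ x = 0 := by
      intro x
      simp only [rk, sum_eq_zero_iff, mem_univ, true_imp_iff]
      constructor
      · intro h; funext j; exact Fin.ext (h j)
      · rintro rfl; simp
    refine ⟨Unit, inferInstance, fun _ => 1, fun _ _ => 0, fun _ => zero_le_one, ?_, ?_⟩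
    · intro _ i _ hi
      rw [Nat.le_zero.1 hi]; exact (h0 0).2 rfl
    · intro i j hij hj F
      obtain rfl : j = 0 := by omega
      obtain rfl : i = 0 := by omega
      simp [h0, ell_zero, Matrix.one_apply, sum_filter]
  | succ m ih =>
    obtain ⟨Ω, _, w, p, hw, hrk, hF⟩ := ih (by omega)
    refine ⟨Ω × (Fin n → Fin 3), inferInstance, fun a => w a.1 * U (p a.1 m) a.2,
      fun a i => if i ≤ m then p a.1 i else a.2, fun a => mul_nonneg (hw _) (hU.nonneg _ _), ?_, ?_⟩
    · rintro ⟨a, z⟩ i ha hi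
      by_cases h : i ≤ m
      · simp only [h, if_true]; exact hrk a i (left_ne_zero_of_mul ha) h
      · have h1 := (hU.supp _ _ (right_ne_zero_of_mul ha)).rk_eq
        rw [hrk a m (left_ne_zero_of_mul ha) le_rfl] at h1
        simp only [h, if_false]
        simp only at h1; omega
    · intro i j hij hj F
      rw [Fintype.sum_prod_type]
      by_cases hjm : j ≤ m
      · simp only [hjm, hij.trans hjm, if_true]
        rw [← hF i j hij hjm F]
        refine sum_congr rfl fun a _ => ?_
        by_cases ha : w a = 0
        · simp [ha]
        · simp only [mul_assoc]
          rw [← mul_sum, ← sum_mul, hU.row _ (by rw [hrk a m ha le_rfl]; omega), one_mul]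
      · obtain rfl : j = m + 1 := by omega
        by_cases him : i ≤ m
        · simp only [hjm, him, if_true, if_false, mul_assoc]
          simp only [← mul_sum]
          rw [hF i m him le_rfl fun x y => ∑ z, U y z * F x z]
          refine sum_congr rfl fun x _ => ?_
          rw [Nat.succ_sub him, pow_succ]
          simp only [Matrix.mul_apply, mul_sum, sum_mul, sum_div]
          rw [sum_comm]
          refine sum_congr rfl fun z _ => sum_congr rfl fun y _ => ?_
          ring
        · obtain rfl : i = m + 1 := by omega
          simp only [hjm, if_false, mul_assoc]
          simp only [← mul_sum]
          rw [hF m m le_rfl le_rfl fun _ y => ∑ z, U y z * F z z]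
          simp only [Nat.sub_self, pow_zero, Matrix.one_apply, ite_div, zero_div, ite_mul, zero_mul,
            sum_ite_eq, mem_univ, if_true]
          simp only [mul_sum]
          rw [sum_comm, ← sum_filter_add_sum_filter_not univ (fun z => rk z = m + 1)]
          rw [sum_eq_zero (s := univ.filter fun z => ¬ rk z = m + 1), add_zero]
          · refine sum_congr rfl fun z hz => ?_
            simp only [mem_filter, mem_univ, true_and] at hz
            have hc := hU.col z (by omega)
            rw [hz, Nat.add_sub_cancel, rat] at hc
            have h1 : ∑ x with rk x = m, U x z = ∑ x, U x z := by
              refine sum_subset (subset_univ _) fun x _ hx => ?_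
              by_contra hne
              have := (hU.supp x z hne).rk_eq
              exact hx (by simp; omega)
            have e0 := ell_pos' (n := n) (i := m) (by omega)
            have e1 := ell_pos' (n := n) (i := m + 1) hm
            calc ∑ x with rk x = m, 1 / (ell n m : ℝ) * (U x z * F z z)
                = (∑ x with rk x = m, U x z) * (1 / (ell n m : ℝ) * F z z) := by
                  rw [sum_mul]; exact sum_congr rfl fun x _ => by ring
              _ = _ := by rw [h1, hc]; field_simp
          · intro z hz
            refine sum_eq_zero fun x hx => ?_
            simp only [mem_filter, mem_univ, true_and] at hz hx
            have : U x z = 0 := by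
              by_contra hne
              have := (hU.supp x z hne).rk_eq
              omega
            rw [this]; ring

end LevelChain

section chain
variable {f : ℕ → ℝ} {n k L : ℕ}

/-- Pairs of levels that are at distance at least `k` and not both extreme. -/
def farPairs (n k L : ℕ) (A : Finset ℕ) : Finset (ℕ × ℕ) :=
  (A ×ˢ A).filter fun q => q.1 + k ≤ q.2 ∧ ¬ (q.1 < L ∧ 2 * n < q.2 + L)

lemma mem_farPairs {A : Finset ℕ} {q : ℕ × ℕ} : q ∈ farPairs n k L A ↔
    (q.1 ∈ A ∧ q.2 ∈ A) ∧ q.1 + k ≤ q.2 ∧ ¬ (q.1 < L ∧ 2 * n < q.2 + L) := by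
  simp [farPairs]

lemma card_le_of_bounds {T : Finset ℕ} {a b : ℕ} (h : ∀ t ∈ T, a ≤ t ∧ t ≤ b) :
    #T ≤ b + 1 - a := by
  rw [← Nat.card_Icc]
  exact card_le_card fun t ht => mem_Icc.2 (h t ht)

lemma sum_le_of_small {I A : Finset ℕ} {m : ℝ} {c : ℕ} (hI : ∀ r ∈ I, m ≤ f r)
    (hI' : ∀ r ≤ 2 * n, r ∉ I → f r ≤ m) (hm : 0 ≤ m) (hA : ∀ r ∈ A, r ≤ 2 * n) (hc : #A ≤ c) :
    ∑ r ∈ A, f r ≤ ∑ r ∈ I, (f r - m) + c * m := by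
  have h1 : ∑ r ∈ A, f r = ∑ r ∈ A, (f r - m) + #A * m := by
    rw [sum_sub_distrib]; simp
  have h2 : ∑ r ∈ A, (f r - m) ≤ ∑ r ∈ I, (f r - m) := by
    rw [← sum_filter_add_sum_filter_not A (· ∈ I)]
    have h3 : ∑ r ∈ A with ¬ r ∈ I, (f r - m) ≤ 0 := by
      refine sum_nonpos fun r hr => ?_
      rw [mem_filter] at hr
      linarith [hI' r (hA r hr.1) hr.2]
    have h4 : ∑ r ∈ A with r ∈ I, (f r - m) ≤ ∑ r ∈ I, (f r - m) := by
      refine sum_le_sum_of_subset_of_nonneg (fun r hr => (mem_filter.1 hr).2) fun r hr _ => ?_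
      linarith [hI r hr]
    linarith
  have h5 : (#A : ℝ) ≤ c := by exact_mod_cast hc
  nlinarith

/-- A set of levels has total weight at most that of the `k` largest levels, up to the weights of
far pairs. -/
lemma sum_le_add_farPairs (hk : 1 ≤ k) (hf : ∀ r, 0 ≤ f r)
    (hmono : ∀ a b, a ≤ 2 * n → b ≤ 2 * n → min b (2 * n - b) ≤ min a (2 * n - a) → f b ≤ f a)
    {I : Finset ℕ} {m : ℝ} (hIc : #I = k) (hI : ∀ r ∈ I, m ≤ f r)
    (hI' : ∀ r ≤ 2 * n, r ∉ I → f r ≤ m) (hm : 0 ≤ m)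
    (hext : ∑ r ∈ range (2 * n + 1) with ¬ (L ≤ r ∧ r + L ≤ 2 * n), f r ≤ m)
    (A : Finset ℕ) (hA : ∀ r ∈ A, r ≤ 2 * n) :
    ∑ r ∈ A, f r ≤ ∑ r ∈ I, f r + ∑ q ∈ farPairs n k L A, min (f q.1) (f q.2) := by
  induction A using Finset.strongInduction with
  | H A ih =>
    have hIm : ∑ r ∈ I, f r = ∑ r ∈ I, (f r - m) + k * m := by
      rw [sum_sub_distrib, ← hIc]; simp
    have hP : 0 ≤ ∑ q ∈ farPairs n k L A, min (f q.1) (f q.2) :=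
      sum_nonneg fun q _ => le_min (hf _) (hf _)
    by_cases hAk : #A ≤ k
    · have := sum_le_of_small hI hI' hm hA hAk
      linarith
    set T := A.filter fun r => L ≤ r ∧ r + L ≤ 2 * n with hT
    by_cases hTk : #T ≤ k - 1
    · have h1 := sum_le_of_small hI hI' hm (fun r hr => hA r (mem_of_mem_filter r hr)) hTk
      have h2 : ∑ r ∈ A with ¬ (L ≤ r ∧ r + L ≤ 2 * n), f r ≤ m := by
        refine (sum_le_sum_of_subset_of_nonneg ?_ fun _ _ _ => hf _).trans hext
        exact filter_subset_filter _ fun r hr => mem_range.2 (by have := hA r hr; omega)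
      have h3 := sum_filter_add_sum_filter_not A (fun r => L ≤ r ∧ r + L ≤ 2 * n) f
      rw [Nat.cast_sub hk] at h1
      push_cast at h1
      linarith
    have step : ∀ q ∈ farPairs n k L A, ∀ r ∈ A, r = q.1 ∨ r = q.2 → f r ≤ min (f q.1) (f q.2) →
        ∑ r ∈ A, f r ≤ ∑ r ∈ I, f r + ∑ q ∈ farPairs n k L A, min (f q.1) (f q.2) := by
      intro q hq r hr hrq hle
      have h1 := ih (A.erase r) (erase_ssubset hr) fun s hs => hA s (mem_of_mem_erase hs)
      rw [← add_sum_erase A f hr]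
      have h2 : ∑ q ∈ farPairs n k L (A.erase r), min (f q.1) (f q.2) + min (f q.1) (f q.2) ≤
          ∑ q ∈ farPairs n k L A, min (f q.1) (f q.2) := by
        rw [← sum_erase_add (farPairs n k L A) _ hq]
        refine add_le_add_left (sum_le_sum_of_subset_of_nonneg ?_
          fun q _ _ => le_min (hf _) (hf _)) _
        intro q' hq'
        rw [mem_farPairs, mem_erase, mem_erase] at hq'
        rw [mem_erase, mem_farPairs]
        refine ⟨?_, ⟨hq'.1.1.2, hq'.1.2.2⟩, hq'.2⟩
        rintro rfl
        rcases hrq with h | h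
        · exact hq'.1.1.1 h.symm
        · exact hq'.1.2.1 h.symm
      linarith
    have hAne : A.Nonempty := card_pos.1 (by omega)
    have hTne : T.Nonempty := card_pos.1 (by omega)
    have hTA : ∀ r ∈ T, r ∈ A ∧ L ≤ r ∧ r + L ≤ 2 * n := fun r hr => mem_filter.1 hr
    set a := A.min' hAne with ha
    set b := A.max' hAne with hb
    have haA : a ∈ A := min'_mem _ _
    have hbA : b ∈ A := max'_mem _ _
    have hab : ∀ r ∈ A, a ≤ r ∧ r ≤ b := fun r hr => ⟨min'_le _ _ hr, le_max' _ _ hr⟩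
    have hcard := card_le_of_bounds hab
    have ha2 := hA a haA
    have hb2 := hA b hbA
    rcases le_total a (2 * n - b) with h | h
    · have hmin : ∀ s ∈ A, f a ≤ min (f a) (f s) := by
        intro s hs
        have h1 := hab s hs
        have := hA s hs
        exact le_min le_rfl (hmono s a this ha2 (by omega))
      by_cases haL : L ≤ a
      · exact step (a, b) (mem_farPairs.2 ⟨⟨haA, hbA⟩, by simp only; omega, by simp only; omega⟩)
          a haA (Or.inl rfl) (hmin b hbA)
      · have hc := T.max'_mem hTne
        have h1 := card_le_of_bounds (T := T) (a := L) (b := T.max' hTne)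
          fun t ht => ⟨(hTA t ht).2.1, le_max' _ _ ht⟩
        have h2 := hTA _ hc
        exact step (a, T.max' hTne)
          (mem_farPairs.2 ⟨⟨haA, h2.1⟩, by simp only; omega, by simp only; omega⟩)
          a haA (Or.inl rfl) (hmin _ h2.1)
    · have hmin : ∀ s ∈ A, f b ≤ min (f s) (f b) := by
        intro s hs
        have h1 := hab s hs
        have := hA s hs
        exact le_min (hmono s b this hb2 (by omega)) le_rfl
      by_cases hbL : b + L ≤ 2 * n
      · exact step (a, b) (mem_farPairs.2 ⟨⟨haA, hbA⟩, by simp only; omega, by simp only; omega⟩)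
          b hbA (Or.inr rfl) (hmin a haA)
      · have hc := T.min'_mem hTne
        have h1 := card_le_of_bounds (T := T) (a := T.min' hTne) (b := 2 * n - L)
          fun t ht => ⟨min'_le _ _ ht, by have := (hTA t ht).2.2; omega⟩
        have h2 := hTA _ hc
        exact step (T.min' hTne, b)
          (mem_farPairs.2 ⟨⟨h2.1, hbA⟩, by simp only; omega, by simp only; omega⟩)
          b hbA (Or.inr rfl) (hmin _ h2.1)

end chain
lemma two_mul_ell_le {n s : ℕ} (hs : 2 * (s + 1) ≤ n) : 2 * ell n s ≤ ell n (s + 1) := by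
  have h := mul_ell_le n s (by omega)
  have h1 : 2 * (s + 1) * ell n s ≤ n * ell n s := Nat.mul_le_mul_right _ hs
  refine le_of_mul_le_mul_left (a := s + 1) ?_ (Nat.succ_pos s)
  calc (s + 1) * (2 * ell n s) = 2 * (s + 1) * ell n s := by ring
    _ ≤ _ := h1.trans h

lemma two_pow_mul_ell_le {n s d : ℕ} (h : 2 * (s + d) ≤ n) : 2 ^ d * ell n s ≤ ell n (s + d) := by
  induction d with
  | zero => simp
  | succ d ih =>
    calc 2 ^ (d + 1) * ell n s = 2 * (2 ^ d * ell n s) := by ring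
      _ ≤ 2 * ell n (s + d) := Nat.mul_le_mul_left _ (ih (by omega))
      _ ≤ _ := two_mul_ell_le (by omega)

lemma two_mul_le_two_pow (L : ℕ) : 2 * L ≤ 2 ^ L := by
  induction L with
  | zero => simp
  | succ L ih =>
    cases L with
    | zero => simp
    | succ L => have := Nat.one_le_two_pow (n := L); rw [pow_succ]; omega

lemma sum_extreme_le {n k : ℕ} (hk : k ≤ n) :
    ∑ r ∈ range (2 * n + 1) with ¬ (n / 4 ≤ r ∧ r + n / 4 ≤ 2 * n), ell n r ≤
      ell n (n + k / 2) := by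
  set L := n / 4 with hL
  have h1 : ∀ r ∈ (range (2 * n + 1)).filter fun r => ¬ (L ≤ r ∧ r + L ≤ 2 * n),
      ell n r ≤ ell n L := by
    intro r hr
    simp only [mem_filter, mem_range] at hr
    exact ell_le_of_dist (by omega) (by omega) (by omega)
  have h2 : #((range (2 * n + 1)).filter fun r => ¬ (L ≤ r ∧ r + L ≤ 2 * n)) ≤ 2 * L := by
    refine (card_le_card (t := range L ∪ Ioc (2 * n - L) (2 * n)) fun r hr => ?_).trans
      ((card_union_le _ _).trans ?_)
    · simp only [mem_filter, mem_range, mem_union, mem_Ioc] at hr ⊢; omega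
    · rw [card_range, Nat.card_Ioc]; omega
  refine (sum_le_card_nsmul _ _ _ h1).trans ?_
  rw [smul_eq_mul]
  calc _ ≤ 2 ^ L * ell n L := Nat.mul_le_mul_right _ (h2.trans (two_mul_le_two_pow L))
    _ ≤ ell n (L + L) := two_pow_mul_ell_le (by omega)
    _ ≤ _ := ell_le_of_dist (by omega) (by omega) (by omega)

lemma sum_levels_le {n k : ℕ} (hk : 1 ≤ k) (hkn : k ≤ n) (A : Finset ℕ) (hA : ∀ r ∈ A, r ≤ 2 * n) :
    ∑ r ∈ A, (ell n r : ℝ) ≤ ∑ r ∈ Icc (n - (k - 1) / 2) (n + k / 2), (ell n r : ℝ) +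
      ∑ q ∈ farPairs n k (n / 4) A, min (ell n q.1 : ℝ) (ell n q.2) := by
  refine sum_le_add_farPairs (m := (ell n (n + k / 2) : ℝ)) hk (fun _ => Nat.cast_nonneg _) ?_ ?_
    ?_ ?_ (Nat.cast_nonneg _) ?_ A hA
  · intro a b ha hb h
    exact_mod_cast ell_le_of_dist ha hb h
  · rw [Nat.card_Icc]; omega
  · intro r hr
    rw [mem_Icc] at hr
    exact_mod_cast ell_le_of_dist (by omega) (by omega) (by omega)
  · intro r hr hr'
    rw [mem_Icc] at hr'
    exact_mod_cast ell_le_of_dist (by omega) (by omega) (by omega)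
  · exact_mod_cast sum_extreme_le hkn

open Classical in
lemma compPairs_eq {α : Type*} [PartialOrder α] (S : Finset α) :
    compPairs S = #((S ×ˢ S).filter fun q => q.1 < q.2) := by
  rw [compPairs, ← Nat.subtype_card _ fun q => ?_]
  simp [and_assoc]

namespace LevelChain

variable {n : ℕ} {U : Matrix (Fin n → Fin 3) (Fin n → Fin 3) ℝ}

open Classical in
lemma farPair_term_le (hU : LevelChain n U) {k : ℕ} (hk : 1 ≤ k) {e : ℝ} (he : 0 ≤ e)
    (hJ : ∀ x y : Fin n → Fin 3, ∀ d, k ≤ d → ¬ (rk x < n / 4 ∧ 2 * n < rk y + n / 4) →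
      rk y = rk x + d →
      min (ell n (rk x) : ℝ) (ell n (rk y)) * ((U ^ d) x y / ell n (rk x)) ≤ e)
    (S : Finset (Fin n → Fin 3)) (q : ℕ × ℕ) (hq : q.1 + k ≤ q.2)
    (hq' : ¬ (q.1 < n / 4 ∧ 2 * n < q.2 + n / 4)) :
    min (ell n q.1 : ℝ) (ell n q.2) * ∑ x with rk x = q.1, ∑ y,
        (U ^ (q.2 - q.1)) x y / ell n q.1 * (if x ∈ S ∧ y ∈ S then 1 else 0) ≤
      e * #(((S ×ˢ S).filter fun z => z.1 < z.2).filter fun z => (rk z.1, rk z.2) = q) := by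
  rw [filter_filter, card_filter, sum_product, Nat.cast_sum, mul_sum, mul_sum, sum_filter,
    ← sum_subset (subset_univ S)]
  · refine sum_le_sum fun x hx => ?_
    rw [Nat.cast_sum, mul_sum]
    split_ifs with hxq
    · rw [mul_sum, ← sum_subset (subset_univ S)]
      · refine sum_le_sum fun y hy => ?_
        simp only [hx, hy, and_self, if_true, mul_one]
        by_cases h : (U ^ (q.2 - q.1)) x y = 0
        · rw [h, zero_div, mul_zero]; positivity
        · obtain ⟨h1, h2⟩ := hU.pow_supp h
          have hyq : rk y = q.2 := by omega
          have hxy : x < y := lt_of_le_of_ne h1 (by rintro rfl; omega)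
          rw [if_pos ⟨hxy, by rw [hxq, hyq]⟩, ← hxq, ← hyq, Nat.cast_one, mul_one]
          exact hJ x y _ (by omega) (by rwa [hxq, hyq]) (by omega)
      · intro y _ hy; simp [hy]
    · exact mul_nonneg he (sum_nonneg fun _ _ => Nat.cast_nonneg _)
  · intro x _ hx; simp [hx]

lemma card_le (hU : LevelChain n U) {k : ℕ} (hk : 1 ≤ k) (hkn : k ≤ n) {e : ℝ} (he : 0 ≤ e)
    (hJ : ∀ x y : Fin n → Fin 3, ∀ d, k ≤ d → ¬ (rk x < n / 4 ∧ 2 * n < rk y + n / 4) →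
      rk y = rk x + d →
      min (ell n (rk x) : ℝ) (ell n (rk y)) * ((U ^ d) x y / ell n (rk x)) ≤ e)
    (S : Finset (Fin n → Fin 3)) :
    (#S : ℝ) ≤ ∑ r ∈ Icc (n - (k - 1) / 2) (n + k / 2), (ell n r : ℝ) + e * compPairs S := by
  classical
  obtain ⟨Ω, _, w, p, hw, -, hF⟩ := hU.exists_paths (2 * n) le_rfl
  set C := ∑ r ∈ Icc (n - (k - 1) / 2) (n + k / 2), (ell n r : ℝ)
  set A : Ω → Finset ℕ := fun a => (range (2 * n + 1)).filter fun r => p a r ∈ S with hA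
  have hlev : ∀ i ≤ 2 * n, ∀ F : (Fin n → Fin 3) → ℝ,
      ∑ a, w a * F (p a i) = ∑ x with rk x = i, F x / ell n i := by
    intro i hi F
    rw [hF i i le_rfl hi fun x _ => F x]
    refine sum_congr rfl fun x _ => ?_
    simp only [Nat.sub_self, pow_zero, Matrix.one_apply, ite_div, zero_div, ite_mul, zero_mul,
      sum_ite_eq, mem_univ, if_true]
    ring
  have htot : ∑ a, w a = 1 := by
    have h := hlev 0 (Nat.zero_le _) fun _ => 1
    have h1 := ell_zero n
    rw [ell_eq_card] at h1
    simpa [ell_zero, h1] using h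
  have hleft : ∑ a, w a * ∑ r ∈ A a, (ell n r : ℝ) = #S := by
    have h1 : ∀ a, w a * ∑ r ∈ A a, (ell n r : ℝ) =
        ∑ r ∈ range (2 * n + 1), ell n r * (w a * if p a r ∈ S then 1 else 0) := by
      intro a
      rw [hA, sum_filter, mul_sum]
      exact sum_congr rfl fun r _ => by split_ifs <;> ring
    simp only [h1]
    rw [sum_comm, card_eq_sum_card_fiberwise (f := rk) (t := range (2 * n + 1))
      (fun x _ => by simpa [Nat.lt_succ_iff] using rk_le x), Nat.cast_sum]
    refine sum_congr rfl fun r hr => ?_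
    have hr' : r ≤ 2 * n := by simpa [Nat.lt_succ_iff] using hr
    have h0 := ell_pos' (n := n) hr'
    rw [← mul_sum, hlev r hr' fun x => if x ∈ S then 1 else 0, ← sum_div, mul_div_cancel₀ _ h0.ne',
      sum_boole, filter_filter]
    congr 2
    ext x; simp [and_comm]
  have hright : ∑ a, w a * ∑ q ∈ farPairs n k (n / 4) (A a), min (ell n q.1 : ℝ) (ell n q.2) ≤
      e * compPairs S := by
    have h1 : ∀ a, w a * ∑ q ∈ farPairs n k (n / 4) (A a), min (ell n q.1 : ℝ) (ell n q.2) =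
        ∑ q ∈ farPairs n k (n / 4) (range (2 * n + 1)), min (ell n q.1 : ℝ) (ell n q.2) *
          (w a * if p a q.1 ∈ S ∧ p a q.2 ∈ S then 1 else 0) := by
      intro a
      have : farPairs n k (n / 4) (A a) = (farPairs n k (n / 4) (range (2 * n + 1))).filter
          fun q => p a q.1 ∈ S ∧ p a q.2 ∈ S := by
        ext q
        simp only [mem_farPairs, mem_filter, hA]
        tauto
      rw [this, sum_filter, mul_sum]
      exact sum_congr rfl fun r _ => by split_ifs <;> ring
    simp only [h1]
    rw [sum_comm]
    calc _ ≤ ∑ q ∈ farPairs n k (n / 4) (range (2 * n + 1)),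
          e * (#(((S ×ˢ S).filter fun z => z.1 < z.2).filter
            fun z => (rk z.1, rk z.2) = q) : ℝ) := by
          refine sum_le_sum fun q hq => ?_
          rw [mem_farPairs, mem_range, mem_range] at hq
          rw [← mul_sum, hF q.1 q.2 (by omega) (by omega)
            fun x y => if x ∈ S ∧ y ∈ S then 1 else 0]
          exact hU.farPair_term_le hk he hJ S q hq.2.1 hq.2.2
      _ = e * (#(((S ×ˢ S).filter fun z => z.1 < z.2).filter fun z => (rk z.1, rk z.2) ∈
            farPairs n k (n / 4) (range (2 * n + 1))) : ℝ) := by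
          rw [← mul_sum, ← Nat.cast_sum, sum_card_fiberwise_eq_card_filter]
      _ ≤ _ := by
          refine mul_le_mul_of_nonneg_left ?_ he
          rw [compPairs_eq]
          exact_mod_cast card_filter_le _ _
  calc (#S : ℝ) = ∑ a, w a * ∑ r ∈ A a, (ell n r : ℝ) := hleft.symm
    _ ≤ ∑ a, w a * (C + ∑ q ∈ farPairs n k (n / 4) (A a), min (ell n q.1 : ℝ) (ell n q.2)) := by
        refine sum_le_sum fun a _ => mul_le_mul_of_nonneg_left (sum_levels_le hk hkn (A a) ?_) (hw a)
        intro r hr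
        have := mem_range.1 (mem_filter.1 hr).1
        omega
    _ = C + ∑ a, w a * ∑ q ∈ farPairs n k (n / 4) (A a), min (ell n q.1 : ℝ) (ell n q.2) := by
        simp only [mul_add]
        rw [sum_add_distrib, ← sum_mul, htot, one_mul]
    _ ≤ _ := by linarith

end LevelChain

open Filter Topology

lemma ell_add_mul_le (n s d : ℕ) :
    ell n (s + d) * (s + 1).ascFactorial d ≤ (n + s + d) ^ d * ell n s := by
  induction d with
  | zero => simp
  | succ d ih =>
    have h := mul_ell_ge n (s + d)
    rw [Nat.ascFactorial_succ]
    calc ell n (s + (d + 1)) * ((s + 1 + d) * (s + 1).ascFactorial d)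
        = ((s + d + 1) * ell n (s + d + 1)) * (s + 1).ascFactorial d := by
          rw [← add_assoc s d 1]; ring
      _ ≤ ((n + (s + d)) * ell n (s + d)) * (s + 1).ascFactorial d := Nat.mul_le_mul_right _ h
      _ = (n + (s + d)) * (ell n (s + d) * (s + 1).ascFactorial d) := by ring
      _ ≤ (n + s + (d + 1)) * ((n + s + (d + 1)) ^ d * ell n s) := by
          refine Nat.mul_le_mul (by omega) (ih.trans (Nat.mul_le_mul_right _ ?_))
          exact Nat.pow_le_pow_left (by omega) _
      _ = _ := by ring

lemma ascFactorial_ge (j : ℕ) :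
    (2 : ℝ) ^ (j + 1) * (j + 1).factorial * 2.5 ^ j ≤ (2 * (j + 1)).ascFactorial (j + 1) := by
  have key : (2 : ℝ) ^ (j + 1) * (j + 1).factorial * 2.5 ^ j * (2 * j + 1).factorial ≤
      (3 * j + 2).factorial := by
    induction j with
    | zero => norm_num
    | succ j ih =>
      rw [show 2 * (j + 1) + 1 = (2 * j + 1) + 1 + 1 by ring,
        show 3 * (j + 1) + 2 = (3 * j + 2) + 1 + 1 + 1 by ring]
      simp only [Nat.factorial_succ (2 * j + 1 + 1), Nat.factorial_succ (2 * j + 1),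
        Nat.factorial_succ (3 * j + 2 + 1 + 1), Nat.factorial_succ (3 * j + 2 + 1),
        Nat.factorial_succ (3 * j + 2), Nat.factorial_succ (j + 1)]
      push_cast
      have hj : (0 : ℝ) ≤ j := Nat.cast_nonneg j
      have h1 : (10 : ℝ) * (j + 2) * (j + 1) * (2 * j + 3) ≤
          (3 * j + 5) * (3 * j + 4) * (3 * j + 3) := by nlinarith [mul_nonneg hj hj]
      have h2 : (0 : ℝ) ≤ ((3 * j + 2).factorial : ℝ) := Nat.cast_nonneg _
      calc _ = (10 * (j + 2) * (j + 1) * (2 * j + 3)) *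
            ((2 : ℝ) ^ (j + 1) * (j + 1).factorial * 2.5 ^ j * (2 * j + 1).factorial) := by ring
        _ ≤ (10 * (j + 2) * (j + 1) * (2 * j + 3)) * ((3 * j + 2).factorial : ℝ) :=
            mul_le_mul_of_nonneg_left ih (by positivity)
        _ ≤ ((3 * j + 5) * (3 * j + 4) * (3 * j + 3)) * ((3 * j + 2).factorial : ℝ) :=
            mul_le_mul_of_nonneg_right h1 h2
        _ = _ := by ring
  have h := Nat.factorial_mul_ascFactorial (2 * j + 1) (j + 1)
  rw [show 2 * j + 1 + (j + 1) = 3 * j + 2 by ring] at h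
  rw [show 2 * (j + 1) = 2 * j + 1 + 1 by ring]
  have h0 : (0 : ℝ) < (2 * j + 1).factorial := by exact_mod_cast Nat.factorial_pos _
  refine le_of_mul_le_mul_right (key.trans_eq ?_) h0
  rw [← h]; push_cast; ring

lemma tendsto_ratio (k : ℕ) :
    Tendsto (fun n : ℕ => (((n : ℝ) + 3 * k) / ((n : ℝ) - 1)) ^ k) atTop (𝓝 1) := by
  have h0 : Tendsto (fun n : ℕ => (n : ℝ) - 1) atTop atTop :=
    tendsto_atTop_add_const_right _ _ tendsto_natCast_atTop_atTop
  have h1 : Tendsto (fun n : ℕ => 1 + (3 * (k : ℝ) + 1) / ((n : ℝ) - 1)) atTop (𝓝 (1 + 0)) :=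
    tendsto_const_nhds.add (h0.const_div_atTop _)
  rw [add_zero] at h1
  have h2 := h1.pow k
  rw [one_pow] at h2
  refine h2.congr' ?_
  filter_upwards [eventually_ge_atTop 2] with n hn
  have : (2 : ℝ) ≤ n := by exact_mod_cast hn
  congr 1
  rw [eq_div_iff (by linarith), add_mul, div_mul_cancel₀ _ (by linarith)]
  ring

/-- The ratio of levels in the statement, minus one. -/
noncomputable def gain (n k : ℕ) : ℝ := (ell n (3 * k - 1) : ℝ) / ell n (2 * k - 1) - 1

lemma gain_le {n k : ℕ} (hk : 1 ≤ k) (hkn : k ≤ n) :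
    gain n k ≤ ((n : ℝ) + 3 * k) ^ k / (2 * k).ascFactorial k := by
  have h := ell_add_mul_le n (2 * k - 1) k
  rw [show 2 * k - 1 + k = 3 * k - 1 by omega, show 2 * k - 1 + 1 = 2 * k by omega] at h
  have h1 : (n + (2 * k - 1) + k) ^ k ≤ (n + 3 * k) ^ k := Nat.pow_le_pow_left (by omega) _
  have h2 := h.trans (Nat.mul_le_mul_right _ h1)
  have h3 : (ell n (3 * k - 1) : ℝ) * (2 * k).ascFactorial k ≤
      ((n : ℝ) + 3 * k) ^ k * ell n (2 * k - 1) := by exact_mod_cast h2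
  have h4 := ell_pos' (n := n) (i := 2 * k - 1) (by omega)
  have h5 : (0 : ℝ) < (2 * k).ascFactorial k := by
    rw [← Nat.sub_add_cancel (show 1 ≤ 2 * k by omega)]
    exact_mod_cast Nat.ascFactorial_pos _ _
  have : (ell n (3 * k - 1) : ℝ) / ell n (2 * k - 1) ≤
      ((n : ℝ) + 3 * k) ^ k / (2 * k).ascFactorial k := by
    rw [div_le_div_iff₀ h4 h5]; exact h3
  rw [gain]; linarith

lemma eventually_gain_near (k : ℕ) (hk : 1 ≤ k) :
    ∀ᶠ n : ℕ in atTop, gain n k * (k.factorial * (lam n * (2.1 * lam n) ^ (k - 1))) ≤ 1 := by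
  obtain ⟨j, rfl⟩ : ∃ j, k = j + 1 := ⟨k - 1, by omega⟩
  cases j with
  | zero =>
    filter_upwards [eventually_ge_atTop 2] with n hn
    have h := mul_ell_ge n 1
    have h1 : (2 : ℝ) * ell n 2 ≤ (n + 1) * ell n 1 := by exact_mod_cast h
    have h2 := ell_pos' (n := n) (i := 1) (by omega)
    have hl := lam_pos hn
    have h3 : gain n 1 ≤ ((n : ℝ) - 1) / 2 := by
      have : (ell n 2 : ℝ) / ell n 1 ≤ (n + 1) / 2 := by
        rw [div_le_div_iff₀ h2 two_pos]; linarith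
      simp only [gain]; norm_num; linarith
    have h4 := lam_mul hn
    have h5 := mul_le_mul_of_nonneg_right h3 hl.le
    simp only [zero_add, Nat.factorial_one, Nat.cast_one, Nat.sub_self, pow_zero, mul_one, one_mul]
    linarith
  | succ j =>
    have hlim : (0.84 : ℝ) ^ (j + 1) < 1 := pow_lt_one₀ (by norm_num) (by norm_num) (by omega)
    have ht := (tendsto_ratio (j + 1 + 1)).mul_const ((0.84 : ℝ) ^ (j + 1))
    rw [one_mul] at ht
    filter_upwards [ht.eventually_le_const hlim, eventually_ge_atTop (j + 1 + 1)] with n h1 hn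
    have hn' : (2 : ℝ) ≤ n := by exact_mod_cast (by omega : 2 ≤ n)
    have hl := lam_pos (n := n) (by omega)
    have hg := gain_le (n := n) (by omega) hn
    have ha := ascFactorial_ge (j + 1)
    set D : ℝ := (((2 * (j + 1 + 1)).ascFactorial (j + 1 + 1) : ℕ) : ℝ) with hD
    have hB : 0 < (2 : ℝ) ^ (j + 1 + 1) * (j + 1 + 1).factorial * 2.5 ^ (j + 1) := by positivity
    have hg2 := hg.trans (div_le_div_of_nonneg_left (by positivity) hB ha)
    refine (mul_le_mul_of_nonneg_right hg2 (by positivity)).trans (le_trans (le_of_eq ?_) h1)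
    have hx : (n : ℝ) - 1 ≠ 0 := by linarith
    have hf : (((j + 1 + 1).factorial : ℕ) : ℝ) ≠ 0 := by positivity
    rw [lam, Nat.add_sub_cancel, show (0.84 : ℝ) = 2.1 / 2.5 by norm_num, mul_pow, div_pow, div_pow,
      div_pow, pow_succ (2 : ℝ) (j + 1), pow_succ ((n : ℝ) - 1) (j + 1)]
    field_simp

lemma eventually_gain_far (k : ℕ) (hk : 1 ≤ k) :
    ∀ᶠ n : ℕ in atTop, gain n k * ((k + 1).factorial * (5 * lam n) ^ (k + 1)) ≤ 1 := by
  set D : ℝ := (((2 * k).ascFactorial k : ℕ) : ℝ) with hD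
  have hDp : (0 : ℝ) < D := by
    rw [hD, ← Nat.sub_add_cancel (show 1 ≤ 2 * k by omega)]
    exact_mod_cast Nat.ascFactorial_pos _ _
  have h0 : Tendsto (fun n : ℕ => (n : ℝ) - 1) atTop atTop :=
    tendsto_atTop_add_const_right _ _ tendsto_natCast_atTop_atTop
  have ht := (tendsto_ratio k).mul
    (h0.const_div_atTop (((k + 1).factorial : ℕ) * (10 : ℝ) ^ (k + 1) / D))
  rw [mul_zero] at ht
  filter_upwards [ht.eventually_le_const one_pos, eventually_ge_atTop k, eventually_ge_atTop 2]
    with n h1 hn h2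
  have hn' : (2 : ℝ) ≤ n := by exact_mod_cast h2
  have hl := lam_pos h2
  have hg := gain_le (n := n) hk hn
  refine (mul_le_mul_of_nonneg_right hg (by positivity)).trans (le_trans (le_of_eq ?_) h1)
  have hx : (n : ℝ) - 1 ≠ 0 := by linarith
  rw [← hD, lam, mul_div_assoc', show (5 : ℝ) * 2 = 10 by norm_num, div_pow, div_pow,
    pow_succ ((n : ℝ) - 1) k]
  field_simp

end MultisetSupersaturation

open MultisetSupersaturation in
/-- Supersaturation in the poset `{0,1,2}^n` (ordered pointwise). -/
theorem multisetSupersaturation (k : ℕ) (hk : 1 ≤ k) :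
    ∃ n0 : ℕ, ∀ n : ℕ, n0 ≤ n →
      ∀ (S : Finset (Fin n → Fin 3)) (t : ℕ),
        (∑ r ∈ Finset.Icc (n - (k - 1) / 2) (n + k / 2), ell n r) + t ≤ S.card →
        ((ell n (3 * k - 1) : ℚ) / (ell n (2 * k - 1)) - 1) * t ≤ (compPairs S : ℚ) := by
  obtain ⟨n1, h1⟩ := Filter.eventually_atTop.1 (eventually_gain_near k hk)
  obtain ⟨n2, h2⟩ := Filter.eventually_atTop.1 (eventually_gain_far k hk)
  refine ⟨n1 + n2 + 11 * k + 20, fun n hn S t hS => ?_⟩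
  obtain ⟨U, hU⟩ := exists_levelChain n (by omega)
  have h1 := h1 n (by omega)
  have h2 := h2 n (by omega)
  set e1 := (k.factorial : ℝ) * (lam n * (2.1 * lam n) ^ (k - 1))
  set e2 := ((k + 1).factorial : ℝ) * (5 * lam n) ^ (k + 1)
  have hl := lam_pos (n := n) (by omega)
  have he : 0 ≤ max e1 e2 := le_max_of_le_left (by positivity)
  have hc := hU.card_le hk (by omega) he (fun x y d hd hxy hrk =>
    hU.joint_le (by omega) hk (by omega) (le_max_left _ _) (le_max_right _ _) x y hd hxy hrk) S
  have hS' : ∑ r ∈ Finset.Icc (n - (k - 1) / 2) (n + k / 2), (ell n r : ℝ) + t ≤ S.card := by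
    exact_mod_cast hS
  have ht : (t : ℝ) ≤ max e1 e2 * compPairs S := by linarith
  have hm : gain n k * max e1 e2 ≤ 1 := by
    rcases max_choice e1 e2 with h | h <;> rw [h] <;> assumption
  suffices gain n k * t ≤ compPairs S by
    rw [gain] at this
    rw [← Rat.cast_le (K := ℝ)]
    push_cast
    exact this
  rcases le_total (gain n k) 0 with hg | hg
  · exact (mul_nonpos_of_nonpos_of_nonneg hg (Nat.cast_nonneg _)).trans (Nat.cast_nonneg _)
  · calc gain n k * t ≤ gain n k * (max e1 e2 * compPairs S) := mul_le_mul_of_nonneg_left ht hg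
      _ = gain n k * max e1 e2 * compPairs S := by ring
      _ ≤ compPairs S := mul_le_of_le_one_left (Nat.cast_nonneg _) hm
end

section
/- Let k be a positive integer. There exists a constant n0(k) such that for every n ≥ n0(k) the following holds: if S is a collection of subsets of [n] = {1,…,n} and t is a nonnegative integer such that |S| ≥ (Σ_{r=0}^{k−1} C(n, ⌈(n−k+1+2r)/2⌉)) + t, then comp(S) ≥ t · C(⌈(n+k)/2⌉, k), where C(a,b) denotes the binomial coefficient. -/
namespace BooleanSupersaturation

open Finset

/-! ### Binomial coefficients -/

lemma choose_le_choose_of_add_le {n i j : ℕ} (hij : i ≤ j) (h : i + j ≤ n) :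
    n.choose i ≤ n.choose j := by
  have mono : ∀ d i : ℕ, 2 * (i + d) ≤ n → n.choose i ≤ n.choose (i + d) := by
    intro d
    induction d with
    | zero => intro i _; rfl
    | succ d ih =>
      intro i hi
      exact (ih i (by omega)).trans (Nat.choose_le_succ_of_lt_half_left (by omega))
  rcases le_or_gt (2 * j) n with hj | hj
  · obtain ⟨d, rfl⟩ := Nat.exists_eq_add_of_le hij
    exact mono d i hj
  · rw [← Nat.choose_symm (show j ≤ n by omega)]
    obtain ⟨d, hd⟩ := Nat.exists_eq_add_of_le (show i ≤ n - j by omega)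
    rw [hd]
    exact mono d i (by omega)

lemma choose_le_choose_of_min_le {n i j : ℕ} (hj : j ≤ n) (h : min i (n - i) ≤ min j (n - j)) :
    n.choose i ≤ n.choose j := by
  rcases le_or_gt i n with hi | hi
  · rcases le_total i (n - i) with h' | h'
    · exact choose_le_choose_of_add_le (by omega) (by omega)
    · rw [← Nat.choose_symm hi]
      exact choose_le_choose_of_add_le (by omega) (by omega)
  · simp [Nat.choose_eq_zero_of_lt hi]

/-- The `k` middle levels of the boolean lattice `P(n)`. -/
def middleLevels (n k : ℕ) : Finset ℕ := Ico ((n - k + 2) / 2) ((n - k + 2) / 2 + k)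

lemma card_middleLevels (n k : ℕ) : #(middleLevels n k) = k := by simp [middleLevels]

lemma sum_choose_le_sum_middleLevels {n k : ℕ} (hkn : k ≤ n) {Y : Finset ℕ}
    (hYk : #Y ≤ k) :
    ∑ a ∈ Y, n.choose a ≤ ∑ a ∈ middleLevels n k, n.choose a := by
  set M := middleLevels n k with hM
  set μ := n.choose ((n + k) / 2)
  have h1 : ∑ a ∈ Y \ M, n.choose a ≤ #(Y \ M) * μ := by
    refine Finset.sum_le_card_nsmul _ _ _ fun a ha => ?_
    have h := (mem_sdiff.1 ha).2
    rw [hM, middleLevels, mem_Ico] at h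
    exact choose_le_choose_of_min_le (by omega) (by omega)
  have h2 : #(M \ Y) * μ ≤ ∑ a ∈ M \ Y, n.choose a := by
    refine Finset.card_nsmul_le_sum _ _ _ fun a ha => ?_
    have h := (mem_sdiff.1 ha).1
    rw [hM, middleLevels, mem_Ico] at h
    exact choose_le_choose_of_min_le (by omega) (by omega)
  have h3 : #(Y \ M) ≤ #(M \ Y) := by
    have e1 := card_sdiff_add_card_inter Y M
    have e2 := card_sdiff_add_card_inter M Y
    rw [inter_comm M Y, card_middleLevels] at e2
    omega
  have h4 := Nat.mul_le_mul_right μ h3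
  rw [← sum_inter_add_sum_sdiff Y M, ← sum_inter_add_sum_sdiff M Y, inter_comm M Y]
  omega

/-! ### Levels hit by a maximal chain -/

/-- The weight of a pair of levels of `P(n)`; it vanishes unless the levels are at distance between
`k` and `n - 2 * k`. -/
def pairWeight (n k a b : ℕ) : ℕ :=
  if a + k ≤ b ∧ b + 2 * k ≤ n + a then min (n.choose a) (n.choose b) else 0

/-- The total weight of the pairs of levels in `X`. -/
def totalWeight (n k : ℕ) (X : Finset ℕ) : ℕ := ∑ p ∈ X ×ˢ X, pairWeight n k p.1 p.2

lemma totalWeight_add_le_insert {n k e b c : ℕ} {X : Finset ℕ} (he : e ∉ X) (hb : b ∈ X)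
    (h : c ≤ pairWeight n k e b + pairWeight n k b e) :
    totalWeight n k X + c ≤ totalWeight n k (insert e X) := by
  have hne : e ≠ b := by rintro rfl; exact he hb
  have hsub : X ×ˢ X ∪ {(e, b), (b, e)} ⊆ insert e X ×ˢ insert e X := by
    intro p hp
    simp only [mem_union, mem_product, mem_insert, mem_singleton] at hp ⊢
    rcases hp with hp | rfl | rfl <;> simp_all
  have hdisj : Disjoint (X ×ˢ X) {(e, b), (b, e)} := by
    simp [Finset.disjoint_right, he]
  calc totalWeight n k X + c
      ≤ totalWeight n k X + ∑ p ∈ {(e, b), (b, e)}, pairWeight n k p.1 p.2 := by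
        rw [sum_pair (by simp [hne])]
        exact Nat.add_le_add_left h _
    _ = ∑ p ∈ X ×ˢ X ∪ {(e, b), (b, e)}, pairWeight n k p.1 p.2 := (sum_union hdisj).symm
    _ ≤ totalWeight n k (insert e X) := sum_le_sum_of_subset hsub

lemma choose_le_pairWeight {n k e b : ℕ} (hb : b ≤ n) (h : min e (n - e) ≤ min b (n - b))
    (hd : (e + k ≤ b ∧ b + 2 * k ≤ n + e) ∨ (b + k ≤ e ∧ e + 2 * k ≤ n + b)) :
    n.choose e ≤ pairWeight n k e b + pairWeight n k b e := by
  have hc := choose_le_choose_of_min_le hb h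
  rcases hd with hd | hd
  · rw [pairWeight, if_pos hd, min_eq_left hc]
    omega
  · rw [pairWeight, pairWeight, if_pos hd, min_eq_right hc]
    omega

lemma sum_choose_le_of_subset_Icc {n k : ℕ} (hk : 1 ≤ k) (hkn : k ≤ n) (Y : Finset ℕ)
    (hY : Y ⊆ Icc (2 * k) (n - 2 * k)) :
    ∑ a ∈ Y, n.choose a ≤ ∑ a ∈ middleLevels n k, n.choose a + totalWeight n k Y := by
  induction hs : #Y generalizing Y with
  | zero => simp [card_eq_zero.1 hs]
  | succ s ih =>
    rcases le_or_gt #Y k with hYk | hYk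
    · exact (sum_choose_le_sum_middleLevels hkn hYk).trans (Nat.le_add_right _ _)
    have hne : Y.Nonempty := card_pos.1 (by omega)
    have hbd : ∀ y ∈ Y, 2 * k ≤ y ∧ y ≤ n - 2 * k := fun y hy => mem_Icc.1 (hY hy)
    obtain ⟨e, he, hmin⟩ := exists_min_image Y (fun y => min y (n - y)) hne
    obtain ⟨b, hb, hbe⟩ : ∃ b ∈ Y, e + k ≤ b ∨ b + k ≤ e := by
      by_contra! hcon
      have hsub : Y ⊆ Ico e (e + k) ∨ Y ⊆ Ioc (e - k) e := by
        rcases le_total e (n - e) with h | h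
        · left
          intro y hy
          have := hmin y hy
          have := hcon y hy
          have := hbd y hy
          have := hbd e he
          rw [mem_Ico]
          omega
        · right
          intro y hy
          have := hmin y hy
          have := hcon y hy
          have := hbd y hy
          have := hbd e he
          rw [mem_Ioc]
          omega
      rcases hsub with h | h
      · have := card_le_card h
        rw [Nat.card_Ico] at this
        omega
      · have := card_le_card h
        rw [Nat.card_Ioc] at this
        omega
    have hbn := hbd b hb
    have hen := hbd e he
    have hbe' : b ∈ Y.erase e := mem_erase.2 ⟨by omega, hb⟩
    have hw := totalWeight_add_le_insert (n := n) (k := k) (notMem_erase e Y) hbe'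
      (choose_le_pairWeight (by omega) (hmin b hb) (by omega))
    rw [insert_erase he] at hw
    have := ih (Y.erase e) ((erase_subset _ _).trans hY) (by rw [card_erase_of_mem he]; omega)
    rw [← sum_erase_add _ _ he]
    omega

lemma sum_choose_le_of_extreme {n k : ℕ} (hk : 1 ≤ k) (hkn : 8 * k ^ 2 + 2 * k ≤ n) {E : Finset ℕ}
    (hE : ∀ a ∈ E, a ≤ n ∧ (a < 2 * k ∨ n - 2 * k < a)) :
    ∑ a ∈ E, n.choose a ≤ n.choose (2 * k) := by
  have hcard : #E ≤ 4 * k := by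
    have hsub : E ⊆ range (2 * k) ∪ Ioc (n - 2 * k) n := by
      intro a ha
      have := hE a ha
      simp only [mem_union, mem_range, mem_Ioc]
      omega
    have h1 := (card_le_card hsub).trans (card_union_le _ _)
    rw [card_range, Nat.card_Ioc] at h1
    omega
  have h1 : ∑ a ∈ E, n.choose a ≤ #E * n.choose (2 * k - 1) := by
    refine sum_le_card_nsmul _ _ _ fun a ha => ?_
    have := hE a ha
    have : 4 * k ≤ n := by nlinarith
    exact choose_le_choose_of_min_le (by omega) (by omega)
  have h2 := Nat.choose_succ_right_eq n (2 * k - 1)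
  rw [show 2 * k - 1 + 1 = 2 * k by omega] at h2
  have h3 : 8 * k ^ 2 ≤ n - (2 * k - 1) := by omega
  have h4 := Nat.mul_le_mul_left (n.choose (2 * k - 1)) h3
  have h5 := Nat.mul_le_mul_right (n.choose (2 * k - 1)) hcard
  refine h1.trans (h5.trans ?_)
  refine Nat.le_of_mul_le_mul_right ?_ (show 0 < 2 * k by omega)
  nlinarith

lemma sum_choose_le_add_totalWeight {n k : ℕ} (hk : 1 ≤ k) (hkn : 8 * k ^ 2 + 2 * k ≤ n)
    (X : Finset ℕ) (hX : ∀ a ∈ X, a ≤ n) :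
    ∑ a ∈ X, n.choose a ≤ ∑ a ∈ middleLevels n k, n.choose a + totalWeight n k X := by
  have hkn' : 10 * k ≤ n := by nlinarith
  set Y := X.filter (· ∈ Icc (2 * k) (n - 2 * k)) with hYdef
  set E := X.filter (· ∉ Icc (2 * k) (n - 2 * k)) with hEdef
  have hYX : Y ∪ E = X := filter_union_filter_not_eq _ _
  have hYE : Disjoint Y E := disjoint_filter_filter_not _ _ _
  have hY : Y ⊆ Icc (2 * k) (n - 2 * k) := fun a ha => (mem_filter.1 ha).2
  have hE : ∀ a ∈ E, a ≤ n ∧ (a < 2 * k ∨ n - 2 * k < a) := by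
    intro a ha
    obtain ⟨h1, h2⟩ := mem_filter.1 ha
    have := hX a h1
    rw [mem_Icc] at h2
    omega
  rcases lt_or_ge #Y k with hYk | hYk
  · obtain ⟨y, hyM, hyY⟩ : ∃ y ∈ middleLevels n k, y ∉ Y :=
      exists_mem_notMem_of_card_lt_card (by rwa [card_middleLevels])
    have h1 := sum_choose_le_sum_middleLevels (n := n) (k := k) (by omega) (Y := insert y Y)
      (by rw [card_insert_of_notMem hyY]; omega)
    rw [sum_insert hyY] at h1
    rw [middleLevels, mem_Ico] at hyM
    have h2 : n.choose (2 * k) ≤ n.choose y := choose_le_choose_of_min_le (by omega) (by omega)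
    have h3 := sum_choose_le_of_extreme hk hkn hE
    rw [← hYX, sum_union hYE]
    omega
  · have key : ∀ F : Finset ℕ, F ⊆ E → ∑ a ∈ Y ∪ F, n.choose a ≤
        ∑ a ∈ middleLevels n k, n.choose a + totalWeight n k (Y ∪ F) := by
      intro F
      induction F using Finset.induction_on with
      | empty =>
        intro _
        rw [union_empty]
        exact sum_choose_le_of_subset_Icc hk (by omega) Y hY
      | insert e F heF ih =>
        intro hF
        have heE : e ∈ E := hF (mem_insert_self _ _)
        have he : e ∉ Y ∪ F := by
          rw [mem_union, not_or]
          exact ⟨fun h => Finset.disjoint_left.1 hYE h heE, heF⟩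
        have hen := hE e heE
        obtain ⟨b, hb, hbe⟩ : ∃ b ∈ Y, e + k ≤ b ∧ e < 2 * k ∨ b + k ≤ e ∧ n - 2 * k < e := by
          by_contra! hcon
          have hsub : Y ⊆ Ico (2 * k) (3 * k - 1) ∨ Y ⊆ Ioc (n + 1 - 3 * k) (n - 2 * k) := by
            rcases hen.2 with h | h
            · left
              intro y hy
              have := hcon y hy
              have := mem_Icc.1 (hY hy)
              rw [mem_Ico]
              omega
            · right
              intro y hy
              have := hcon y hy
              have := mem_Icc.1 (hY hy)
              rw [mem_Ioc]
              omega
          rcases hsub with h | h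
          · have := card_le_card h
            rw [Nat.card_Ico] at this
            omega
          · have := card_le_card h
            rw [Nat.card_Ioc] at this
            omega
        have hbY := mem_Icc.1 (hY hb)
        have hw := totalWeight_add_le_insert (n := n) (k := k) he (mem_union_left F hb)
          (choose_le_pairWeight (by omega) (by omega) (by omega))
        have := ih ((subset_insert _ _).trans hF)
        rw [union_insert, sum_insert he]
        omega
    simpa [hYX] using key E Subset.rfl

/-! ### Counting maximal chains -/

open Numbering Nat

lemma card_prefixed_inter_prefixed_le {X : Type*} [Fintype X] [DecidableEq X] {A B : Finset X}
    (hAB : A ⊆ B) :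
    #(prefixed A ∩ prefixed B) ≤ (#A)! * (#B - #A)! * (Fintype.card X - #B)! := by
  set A' : Finset B := A.subtype (· ∈ B) with hA'
  have hcA' : #A' = #A := by
    rw [hA', card_subtype, filter_true_of_mem fun a ha => hAB ha]
  have h1 : prefixed A ∩ prefixed B =
      (univ.filter fun f : prefixed B => f.1 ∈ prefixed A).map
        (Function.Embedding.subtype _) := by
    ext f
    simp [and_comm]
  have h2 : #(univ.filter fun f : prefixed B => f.1 ∈ prefixed A) ≤
      #(prefixed A' ×ˢ (univ : Finset (Numbering ↑(Bᶜ)))) := by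
    refine card_le_card_of_injOn (prefixedEquiv B) ?_ (prefixedEquiv B).injective.injOn
    intro f hf
    have hf' : IsPrefix (f : Numbering X) A := by simpa using hf
    simp only [coe_product, Set.mem_prod, mem_coe, mem_prefixed, mem_univ, and_true]
    intro x
    rw [hcA', hA', mem_subtype]
    exact hf' x
  rw [h1, card_map]
  refine h2.trans ?_
  rw [card_product, card_prefixed, hcA', Finset.card_univ, Fintype.card_numbering]
  simp

lemma pairWeight_mul_card_le {n k : ℕ} {A B : Finset (Fin n)} (hAB : A ⊆ B) :
    pairWeight n k #A #B * #(prefixed A ∩ prefixed B) * ((n + k + 1) / 2).choose k ≤ n ! := by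
  unfold pairWeight
  split_ifs with hd
  swap
  · simp
  have hN := card_prefixed_inter_prefixed_le hAB
  simp only [Fintype.card_fin] at hN
  have hb : #B ≤ n := by simpa using card_le_univ B
  set a := #A
  set b := #B
  have hab : a ≤ b := card_le_card hAB
  have hF : ∀ h, n + (b - a) ≤ 2 * h → ((n + k + 1) / 2).choose k ≤ h.choose (b - a) := fun h hh =>
    (Nat.choose_le_choose k (by omega)).trans (choose_le_choose_of_add_le (by omega) (by omega))
  rcases le_total (n - a) b with hh | hh
  · calc _ ≤ n.choose b * (a ! * (b - a)! * (n - b)!) * b.choose (b - a) := by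
          gcongr
          · exact min_le_right _ _
          · exact hF _ (by omega)
      _ = n.choose b * (b.choose a * a ! * (b - a)!) * (n - b)! := by
          rw [Nat.choose_symm hab]; ring
      _ = n ! := by
          rw [Nat.choose_mul_factorial_mul_factorial hab,
            Nat.choose_mul_factorial_mul_factorial hb]
  · calc _ ≤ n.choose a * (a ! * (b - a)! * (n - b)!) * (n - a).choose (b - a) := by
          gcongr
          · exact min_le_left _ _
          · exact hF _ (by omega)
      _ = n.choose a * a ! * ((n - a).choose (b - a) * (b - a)! * (n - a - (b - a))!) := by
          rw [show n - a - (b - a) = n - b by omega]; ring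
      _ = n ! := by
          rw [Nat.choose_mul_factorial_mul_factorial (by omega),
            Nat.choose_mul_factorial_mul_factorial (by omega)]

lemma compPairs_eq_card {α : Type*} [PartialOrder α] [DecidableLT α] (S : Finset α) :
    compPairs S = #((S ×ˢ S).filter fun p => p.1 < p.2) := by
  rw [compPairs, Nat.subtype_card]
  simp [and_assoc]

lemma card_mul_factorial_le {n k : ℕ} (hk : 1 ≤ k) (hkn : 8 * k ^ 2 + 2 * k ≤ n)
    (S : Finset (Finset (Fin n))) :
    #S * n ! ≤ (∑ a ∈ middleLevels n k, n.choose a) * n ! +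
      ∑ p ∈ S ×ˢ S, pairWeight n k #p.1 #p.2 * #(prefixed p.1 ∩ prefixed p.2) := by
  have hchain : ∀ f : Numbering (Fin n),
      ∑ A ∈ S with f ∈ prefixed A, n.choose #A ≤ ∑ a ∈ middleLevels n k, n.choose a +
        ∑ p ∈ S ×ˢ S with f ∈ prefixed p.1 ∩ prefixed p.2, pairWeight n k #p.1 #p.2 := by
    intro f
    set Sf := S.filter fun A => f ∈ prefixed A with hSf
    have hinj : Set.InjOn card (Sf : Set (Finset (Fin n))) := by
      intro A hA B hB h
      have hA' := mem_prefixed.1 (mem_filter.1 hA).2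
      have hB' := mem_prefixed.1 (mem_filter.1 hB).2
      exact (hA'.subset_of_card_le_card hB' h.le).antisymm
        (hB'.subset_of_card_le_card hA' h.ge)
    have h := sum_choose_le_add_totalWeight hk hkn (Sf.image card) (by
      intro a ha
      obtain ⟨A, -, rfl⟩ := mem_image.1 ha
      simpa using card_le_univ A)
    have hfil : {p ∈ S ×ˢ S | f ∈ prefixed p.1 ∩ prefixed p.2} = Sf ×ˢ Sf := by
      ext p
      simp only [hSf, mem_filter, mem_product, mem_inter]
      tauto
    rw [hfil, sum_product]
    rwa [totalWeight, sum_product, sum_image hinj, sum_image hinj,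
      sum_congr rfl fun A _ => sum_image hinj] at h
  have hsum := sum_le_sum fun f (_ : f ∈ (univ : Finset (Numbering (Fin n)))) => hchain f
  rw [sum_add_distrib, sum_const, Finset.card_univ, Fintype.card_numbering,
    smul_eq_mul, mul_comm (Fintype.card (Fin n))!] at hsum
  simp only [Fintype.card_fin] at hsum
  simp_rw [sum_filter] at hsum
  rw [sum_comm, sum_comm (s := univ) (t := S ×ˢ S)] at hsum
  simp_rw [← sum_filter, sum_const, filter_univ_mem, smul_eq_mul] at hsum
  have hleft : ∑ A ∈ S, #(prefixed A) * n.choose #A = #S * n ! := by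
    rw [← smul_eq_mul, ← sum_const]
    refine sum_congr rfl fun A _ => ?_
    rw [card_prefixed, Fintype.card_fin, mul_comm, ← mul_assoc,
      Nat.choose_mul_factorial_mul_factorial (by simpa using card_le_univ A)]
  rw [hleft] at hsum
  simpa only [mul_comm (pairWeight _ _ _ _)] using hsum

lemma sum_pairWeight_mul_choose_le {n k : ℕ} (hk : 1 ≤ k) (S : Finset (Finset (Fin n))) :
    (∑ p ∈ S ×ˢ S, pairWeight n k #p.1 #p.2 * #(prefixed p.1 ∩ prefixed p.2)) *
      ((n + k + 1) / 2).choose k ≤ compPairs S * n ! := by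
  rw [compPairs_eq_card, sum_mul, ← smul_eq_mul, ← sum_const, sum_filter]
  refine sum_le_sum fun p _ => ?_
  split_ifs with h
  · exact pairWeight_mul_card_le h.le
  · simp only [nonpos_iff_eq_zero, _root_.mul_eq_zero]
    left
    by_contra! hcon
    obtain ⟨h1, h2⟩ := hcon
    obtain ⟨f, hf⟩ := card_pos.1 (Nat.pos_of_ne_zero h2)
    rw [mem_inter, mem_prefixed, mem_prefixed] at hf
    have hd : #p.1 + k ≤ #p.2 := by
      by_contra hd
      exact h1 (if_neg fun h => hd h.1)
    refine h (lt_of_le_of_ne (hf.1.subset_of_card_le_card hf.2 (by omega)) fun he => ?_)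
    rw [he] at hd
    omega

end BooleanSupersaturation

open BooleanSupersaturation in
/-- Supersaturation in the boolean lattice `P(n)` (Kleitman's theorem, approximate form). -/
theorem booleanSupersaturation (k : ℕ) (hk : 1 ≤ k) :
    ∃ n0 : ℕ, ∀ n : ℕ, n0 ≤ n →
      ∀ (S : Finset (Finset (Fin n))) (t : ℕ),
        (∑ r ∈ Finset.range k, Nat.choose n ((n - k + 1 + 2 * r + 1) / 2)) + t ≤ S.card →
        t * Nat.choose ((n + k + 1) / 2) k ≤ compPairs S := by
  refine ⟨8 * k ^ 2 + 2 * k, fun n hn S t hS => ?_⟩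
  have hT : ∑ r ∈ Finset.range k, n.choose ((n - k + 1 + 2 * r + 1) / 2) =
      ∑ a ∈ middleLevels n k, n.choose a := by
    rw [middleLevels, Finset.sum_Ico_eq_sum_range, Nat.add_sub_cancel_left]
    refine Finset.sum_congr rfl fun r _ => ?_
    congr 1
    omega
  rw [hT] at hS
  have h1 := card_mul_factorial_le hk hn S
  have h2 := (Nat.mul_le_mul_right n.factorial hS).trans h1
  rw [add_mul] at h2
  have h3 := Nat.mul_le_mul_right (((n + k + 1) / 2).choose k) (Nat.le_of_add_le_add_left h2)
  refine Nat.le_of_mul_le_mul_right ?_ n.factorial_pos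
  calc _ = t * n.factorial * ((n + k + 1) / 2).choose k := by ring
    _ ≤ _ := h3.trans (sum_pairWeight_mul_choose_le hk S)
end

section
/- Let q be a fixed prime power. There exist constants C > 0 and n0 such that for every n ≥ n0, the number A(n) of antichains in V(q,n) satisfies 2^{[n choose ⌊n/2⌋]_q} ≤ A(n) ≤ 2^{(1 + C·√n·q^{−n/4})·[n choose ⌊n/2⌋]_q}. -/
/-- The Gaussian binomial coefficient `[n choose i]_q`, realized as the number of
`i`-dimensional linear subspaces of `F^n`, where `F` is a field (of cardinality `q`). -/
noncomputable def gaussBinom (F : Type*) [Field F] (n i : ℕ) : ℕ :=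
  Nat.card {W : Submodule F (Fin n → F) // Module.finrank F W = i}

open scoped Classical in
/-- A form of the Kleitman–Winston container bound for antichains: `M` bounds the size of every
set in which each element is comparable to fewer than `t` others. -/
theorem card_antichains_subset_le {α : Type*} [PartialOrder α] (t M : ℕ) (l : ℝ)
    (hl : 1 ≤ l) (hlt : l ^ t + 1 ≤ l ^ (t + 1))
    (hM : ∀ B : Finset α, (∀ x ∈ B, (B.filter fun y => x < y ∨ y < x).card < t) → B.card ≤ M)
    (A : Finset α) :
    ((A.powerset.filter fun I : Finset α => IsAntichain (· ≤ ·) (I : Set α)).card : ℝ) ≤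
      2 ^ M * l ^ A.card := by
  induction A using Finset.strongInduction with
  | H A ih =>
    by_cases hA : ∀ x ∈ A, (A.filter fun y => x < y ∨ y < x).card < t
    · have h1 : (A.powerset.filter fun I : Finset α => IsAntichain (· ≤ ·) (I : Set α)).card ≤ 2 ^ M := by
        refine (Finset.card_filter_le _ _).trans ?_
        rw [Finset.card_powerset]
        exact Nat.pow_le_pow_right (by norm_num) (hM A hA)
      calc _ ≤ ((2 ^ M : ℕ) : ℝ) := by exact_mod_cast h1
        _ = 2 ^ M * 1 := by push_cast; ring
        _ ≤ _ := by gcongr; exact one_le_pow₀ hl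
    · push Not at hA
      obtain ⟨v, hv, hvt⟩ := hA
      set N := A.filter fun y => v < y ∨ y < v
      have hvN : v ∉ N := by simp [N]
      have hNA : N ⊆ A := Finset.filter_subset _ _
      set A₁ := A.erase v with hA₁
      set A₂ := A₁ \ N with hA₂
      have hNA₁ : N ⊆ A₁ := fun y hy => Finset.mem_erase.2 ⟨fun h => hvN (h ▸ hy), hNA hy⟩
      have hlt₁ : A₁ ⊂ A := Finset.erase_ssubset hv
      have hlt₂ : A₂ ⊂ A := (Finset.sdiff_subset).trans_ssubset hlt₁
      have hc₁ : A₁.card + 1 = A.card := Finset.card_erase_add_one hv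
      have hc₂ : A₂.card + N.card = A₁.card := Finset.card_sdiff_add_card_eq_card hNA₁
      have hsub : (A.powerset.filter fun I : Finset α => IsAntichain (· ≤ ·) (I : Set α)) ⊆
          (A₁.powerset.filter fun I : Finset α => IsAntichain (· ≤ ·) (I : Set α)) ∪
          ((A₂.powerset.filter fun I : Finset α => IsAntichain (· ≤ ·) (I : Set α)).image (insert v)) := by
        intro I hI
        rw [Finset.mem_filter, Finset.mem_powerset] at hI
        rw [Finset.mem_union]
        by_cases hvI : v ∈ I
        · right
          refine Finset.mem_image.2 ⟨I.erase v, ?_, Finset.insert_erase hvI⟩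
          rw [Finset.mem_filter, Finset.mem_powerset]
          refine ⟨fun y hy => ?_, hI.2.subset (by simp)⟩
          obtain ⟨hyv, hyI⟩ := Finset.mem_erase.1 hy
          refine Finset.mem_sdiff.2 ⟨Finset.mem_erase.2 ⟨hyv, hI.1 hyI⟩, fun hyN => ?_⟩
          rcases (Finset.mem_filter.1 hyN).2 with h | h
          · exact hI.2 hvI hyI hyv.symm h.le
          · exact hI.2 hyI hvI hyv h.le
        · left
          rw [Finset.mem_filter, Finset.mem_powerset]
          exact ⟨fun y hy => Finset.mem_erase.2 ⟨fun h => hvI (h ▸ hy), hI.1 hy⟩, hI.2⟩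
      have h1 := ih A₁ hlt₁
      have h2 := ih A₂ hlt₂
      have h3 := (Finset.card_le_card hsub).trans ((Finset.card_union_le _ _).trans
        (Nat.add_le_add_left Finset.card_image_le _))
      have h3' := (Nat.cast_le (α := ℝ)).2 h3
      push_cast at h3'
      obtain ⟨d, hd⟩ : ∃ d, A₁.card = d + t := ⟨A₁.card - t, by omega⟩
      have h4 : l ^ A₂.card ≤ l ^ d := pow_le_pow_right₀ hl (by omega)
      calc _ ≤ 2 ^ M * l ^ A₁.card + 2 ^ M * l ^ A₂.card := by linarith
        _ ≤ 2 ^ M * l ^ A₁.card + 2 ^ M * l ^ d := by gcongr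
        _ = 2 ^ M * l ^ d * (l ^ t + 1) := by rw [hd]; ring
        _ ≤ 2 ^ M * l ^ d * l ^ (t + 1) := by gcongr
        _ = _ := by rw [← hc₁, hd]; ring

open Real in
theorem rpow_inv_self_pow_add_one_le {t : ℕ} (ht : 3 ≤ t) :
    ((t : ℝ) ^ (t : ℝ)⁻¹) ^ t + 1 ≤ ((t : ℝ) ^ (t : ℝ)⁻¹) ^ (t + 1) := by
  have ht0 : (0 : ℝ) < t := by positivity
  have h1 : ((t : ℝ) ^ (t : ℝ)⁻¹) ^ t = t := rpow_inv_natCast_pow ht0.le (by omega)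
  have hlog : 1 ≤ log t := by
    rw [le_log_iff_exp_le ht0]
    have : (3 : ℝ) ≤ t := by exact_mod_cast ht
    linarith [exp_one_lt_d9]
  have h2 : 1 + log t * (t : ℝ)⁻¹ ≤ (t : ℝ) ^ (t : ℝ)⁻¹ := by
    rw [rpow_def_of_pos ht0, add_comm]; exact add_one_le_exp _
  rw [pow_succ, h1]
  have : (t : ℝ) * (log t * (t : ℝ)⁻¹) = log t := by field_simp
  nlinarith

namespace Submodule

open Module

section

variable {K V : Type*} [Field K] [AddCommGroup V] [Module K V] [FiniteDimensional K V]

theorem exists_linearEquiv_map_eq {x y : Submodule K V} (h : finrank K x = finrank K y) :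
    ∃ g : V ≃ₗ[K] V, x.map (g : V →ₗ[K] V) = y := by
  obtain ⟨g, hg⟩ := exists_linearEquiv_restrict_eq (LinearEquiv.ofFinrankEq x y h)
  refine ⟨g, Submodule.eq_of_le_of_finrank_eq ?_ ?_⟩
  · rintro _ ⟨v, hv, rfl⟩
    have := hg ⟨v, hv⟩
    exact this ▸ Subtype.property _
  · rw [← h]; exact LinearEquiv.finrank_map_eq g x

theorem exists_linearEquiv_map_eq_of_le {x x' y : Submodule K V} (hx : x ≤ y) (hx' : x' ≤ y)
    (h : finrank K x = finrank K x') :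
    ∃ g : V ≃ₗ[K] V, x.map (g : V →ₗ[K] V) = x' ∧ y.map (g : V →ₗ[K] V) = y := by
  obtain ⟨f, hf⟩ := exists_linearEquiv_map_eq (x := x.comap y.subtype) (y := x'.comap y.subtype)
    (by rw [(comapSubtypeEquivOfLe hx).finrank_eq, (comapSubtypeEquivOfLe hx').finrank_eq, h])
  obtain ⟨g, hg⟩ := exists_linearEquiv_restrict_eq f
  refine ⟨g, eq_of_le_of_finrank_eq ?_ ?_, eq_of_le_of_finrank_eq ?_ ?_⟩
  · rintro _ ⟨v, hv, rfl⟩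
    have h1 : f ⟨v, hx hv⟩ ∈ x'.comap y.subtype := hf ▸ mem_map_of_mem (by simpa using hv)
    have h2 := hg ⟨v, hx hv⟩
    simpa [h2] using h1
  · rw [← h]; exact LinearEquiv.finrank_map_eq g x
  · rintro _ ⟨v, hv, rfl⟩
    have := hg ⟨v, hv⟩
    exact this ▸ Subtype.property _
  · exact LinearEquiv.finrank_map_eq g y

theorem exists_linearEquiv_map_eq_map_eq {x x' y y' : Submodule K V} (hx : x ≤ y) (hx' : x' ≤ y')
    (h : finrank K x = finrank K x') (h' : finrank K y = finrank K y') :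
    ∃ g : V ≃ₗ[K] V, x.map (g : V →ₗ[K] V) = x' ∧ y.map (g : V →ₗ[K] V) = y' := by
  obtain ⟨g₁, hg₁⟩ := exists_linearEquiv_map_eq h'
  obtain ⟨g₂, hg₂, hg₂'⟩ := exists_linearEquiv_map_eq_of_le (x := x.map (g₁ : V →ₗ[K] V))
    (hg₁ ▸ map_mono hx) hx' (by rw [← h]; exact LinearEquiv.finrank_map_eq g₁ x)
  refine ⟨g₁.trans g₂, ?_, ?_⟩
  · rw [← hg₂, ← map_comp]; rfl
  · rw [← hg₂', ← hg₁, ← map_comp]; rfl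

theorem exists_monotone_finrank_eq (K V : Type*) [Field K] [AddCommGroup V] [Module K V]
    [FiniteDimensional K V] :
    ∃ c : ℕ → Submodule K V, Monotone c ∧ ∀ i ≤ finrank K V, finrank K (c i) = i := by
  classical
  let b := finBasis K V
  refine ⟨fun i => span K (b '' {k | (k : ℕ) < i}), fun i j hij => ?_, fun i hi => ?_⟩
  · exact span_mono (Set.image_mono fun k hk => lt_of_lt_of_le hk hij)
  · have h := finrank_span_set_eq_card (R := K) (b.linearIndependent.linearIndepOn_id.mono
      (Set.image_subset_range b {k | (k : ℕ) < i}))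
    rw [h, Set.toFinset_card, ← Nat.card_eq_fintype_card, Nat.card_image_of_injective b.injective,
      Nat.card_eq_fintype_card, Fintype.card_subtype]
    simpa using Fin.card_filter_val_lt (n := finrank K V) (m := i) |>.trans (by simp [hi])

variable [Finite K]

theorem card_pow_le_card_finrank_eq {k l : ℕ} (h : k + l = finrank K V) :
    Nat.card K ^ (k * l) ≤ Nat.card {W : Submodule K V // finrank K W = k} := by
  have : Finite V := Module.finite_of_finite K
  obtain ⟨e⟩ : Nonempty (((Fin k → K) × (Fin l → K)) ≃ₗ[K] V) :=
    ⟨LinearEquiv.ofFinrankEq _ _ (by simp [h])⟩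
  let φ : ((Fin k → K) →ₗ[K] (Fin l → K)) → {W : Submodule K V // finrank K W = k} := fun f =>
    ⟨f.graph.map (e : _ →ₗ[K] V), by
      rw [LinearEquiv.finrank_map_eq e, LinearMap.graph_eq_range_prod,
        LinearMap.finrank_range_of_inj]
      · simp
      · intro a b hab; exact congrArg Prod.fst hab⟩
  have hφ : Function.Injective φ := by
    intro f g hfg
    have h1 := Submodule.map_injective_of_injective e.injective (congrArg Subtype.val hfg)
    ext1 v
    have : (LinearMap.single K (fun _ => K) v 1, f (LinearMap.single K (fun _ => K) v 1)) ∈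
        g.graph := by
      rw [← h1]; simp [LinearMap.mem_graph_iff]
    ext x
    rw [LinearMap.mem_graph_iff] at this
    simpa using congrFun this x
  refine le_trans (le_of_eq ?_) (Nat.card_le_card_of_injective φ hφ)
  rw [Module.natCard_eq_pow_finrank (K := K) (V := (Fin k → K) →ₗ[K] (Fin l → K)),
    finrank_linearMap]
  simp

theorem pow_le_card_le_finrank_eq (y : Submodule K V) {i : ℕ} (h0 : 0 < i) (hi : i < finrank K y) :
    Nat.card K ^ (finrank K y - 1) ≤ Nat.card {x : Submodule K V // x ≤ y ∧ finrank K x = i} := by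
  have : Finite V := Module.finite_of_finite K
  obtain ⟨l, hl⟩ := Nat.exists_eq_add_of_lt hi
  calc _ ≤ Nat.card K ^ (i * (l + 1)) := Nat.pow_le_pow_right Nat.card_pos (by
        obtain ⟨i, rfl⟩ := Nat.exists_eq_succ_of_ne_zero h0.ne'
        rw [hl, Nat.succ_eq_add_one, Nat.add_sub_cancel]; nlinarith [Nat.zero_le (i * l)])
    _ ≤ Nat.card {W : Submodule K y // finrank K W = i} := card_pow_le_card_finrank_eq (by omega)
    _ ≤ _ := by
      refine Nat.card_le_card_of_injective
        (fun W => ⟨W.1.map y.subtype, map_subtype_le y W.1, ?_⟩) fun W W' h => ?_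
      · rw [finrank_map_subtype_eq]; exact W.2
      · exact Subtype.ext (map_injective_of_injective y.injective_subtype (congrArg Subtype.val h))

theorem pow_le_card_ge_finrank_eq (x : Submodule K V) {j : ℕ} (hj : finrank K x < j)
    (hj' : j < finrank K V) :
    Nat.card K ^ (finrank K V - finrank K x - 1) ≤
      Nat.card {y : Submodule K V // x ≤ y ∧ finrank K y = j} := by
  have : Finite V := Module.finite_of_finite K
  obtain ⟨a, ha⟩ := Nat.exists_eq_add_of_lt hj
  obtain ⟨l, hl⟩ := Nat.exists_eq_add_of_lt hj'
  have hq := x.finrank_quotient_add_finrank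
  calc _ ≤ Nat.card K ^ ((a + 1) * (l + 1)) := Nat.pow_le_pow_right Nat.card_pos (by
        rw [hl, ha, show finrank K x + a + 1 + l + 1 - finrank K x - 1 = a + l + 1 by omega]
        nlinarith [Nat.zero_le (a * l)])
    _ ≤ Nat.card {W : Submodule K (V ⧸ x) // finrank K W = a + 1} :=
      card_pow_le_card_finrank_eq (by omega)
    _ ≤ _ := by
      refine Nat.card_le_card_of_injective
        (fun W => ⟨W.1.comap x.mkQ, le_comap_mkQ x W.1, ?_⟩) fun W W' h => ?_
      · have h1 := (x.mkQ.domRestrict (W.1.comap x.mkQ)).finrank_range_add_finrank_ker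
        rw [LinearMap.range_domRestrict, map_comap_eq_of_surjective x.mkQ_surjective,
          LinearMap.ker_domRestrict, ker_mkQ,
          (comapSubtypeEquivOfLe (le_comap_mkQ x W.1)).finrank_eq, W.2] at h1
        omega
      · exact Subtype.ext (comap_injective_of_surjective x.mkQ_surjective (congrArg Subtype.val h))

end

end Submodule

open Finset in
theorem sum_range_le_of_two_mul_le {L : ℕ → ℕ} {m : ℕ} (h : ∀ k < m, 2 * L k ≤ L (k + 1)) :
    ∑ k ∈ range m, L k ≤ L m := by
  induction m with
  | zero => simp
  | succ m ih =>
    rw [sum_range_succ]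
    have := ih fun k hk => h k (by omega)
    have := h m (by omega)
    omega

open Finset in
theorem sum_range_add_two_mul_le {L : ℕ → ℕ} {a : ℕ} (h : ∀ k, a ≤ k → 2 * L (k + 1) ≤ L k)
    (r : ℕ) : ∑ k ∈ range r, L (a + k) + 2 * L (a + r) ≤ 2 * L a := by
  induction r with
  | zero => simp
  | succ r ih =>
    rw [sum_range_succ]
    have := h (a + r) (by omega)
    rw [← add_assoc]
    omega

namespace Submodule

open Module Finset

section

variable (K V : Type*) [Field K] [AddCommGroup V] [Module K V] [FiniteDimensional K V] [Finite K]

theorem card_finrank_eq_mul_prod {k : ℕ} (hk : k ≤ finrank K V) :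
    Nat.card {W : Submodule K V // finrank K W = k} *
      ∏ i : Fin k, (Nat.card K ^ k - Nat.card K ^ i.val) =
      ∏ i : Fin k, (Nat.card K ^ finrank K V - Nat.card K ^ i.val) := by
  have := Fintype.ofFinite K
  have : Finite V := Module.finite_of_finite K
  have := Fintype.ofFinite {W : Submodule K V // finrank K W = k}
  let f : {s : Fin k → V // LinearIndependent K s} → {W : Submodule K V // finrank K W = k} :=
    fun s => ⟨span K (Set.range s.1), by rw [finrank_span_eq_card s.2, Fintype.card_fin]⟩
  have e (W : {W : Submodule K V // finrank K W = k}) :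
      {s // f s = W} ≃ {s : Fin k → W.1 // LinearIndependent K s} :=
    { toFun := fun s => ⟨fun i => ⟨s.1.1 i, (congrArg Subtype.val s.2).le (subset_span ⟨i, rfl⟩)⟩,
        .of_comp W.1.subtype s.1.2⟩
      invFun := fun s => ⟨⟨fun i => s.1 i, s.2.map' W.1.subtype W.1.ker_subtype⟩, by
        refine Subtype.ext (eq_of_le_of_finrank_eq (span_le.2 ?_) ?_)
        · rintro _ ⟨i, rfl⟩; exact (s.1 i).2
        · rw [(f _).2, W.2]⟩
      left_inv := fun s => rfl
      right_inv := fun s => rfl }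
  have h1 := card_linearIndependent (K := K) (V := V) hk
  rw [Nat.card_congr (Equiv.sigmaFiberEquiv f).symm, Nat.card_sigma] at h1
  rw [Nat.card_eq_fintype_card (α := K), ← h1, Finset.sum_congr rfl (g := fun _ =>
    ∏ i : Fin k, (Fintype.card K ^ k - Fintype.card K ^ i.val))]
  · simp
  · rintro W -
    have := card_linearIndependent (K := K) (V := W.1) W.2.ge
    rw [W.2] at this
    rw [Nat.card_congr (e W), this]

theorem card_finrank_eq_succ_mul (k : ℕ) :
    Nat.card {W : Submodule K V // finrank K W = k + 1} * (Nat.card K ^ (k + 1) - 1) =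
      Nat.card {W : Submodule K V // finrank K W = k} * (Nat.card K ^ (finrank K V - k) - 1) := by
  have hq : 1 < Nat.card K := Finite.one_lt_card
  rcases lt_or_ge k (finrank K V) with hk | hk
  · have h1 := card_finrank_eq_mul_prod K V hk.le
    have h2 := card_finrank_eq_mul_prod K V (Nat.succ_le_of_lt hk)
    set q := Nat.card K
    rw [Nat.succ_eq_add_one, Fin.prod_univ_castSucc (n := k)
        (f := fun i : Fin (k + 1) => (q ^ finrank K V - q ^ i.val)), Fin.prod_univ_succ] at h2
    have h3 : ∏ i : Fin k, (q ^ (k + 1) - q ^ i.succ.val) =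
        q ^ k * ∏ i : Fin k, (q ^ k - q ^ i.val) := by
      calc _ = ∏ i : Fin k, q * (q ^ k - q ^ i.val) :=
            Finset.prod_congr rfl fun i _ => by simp [pow_succ, Nat.mul_sub, mul_comm]
        _ = _ := by rw [Finset.prod_mul_distrib]; simp
    have h4 : q ^ finrank K V - q ^ k = q ^ k * (q ^ (finrank K V - k) - 1) := by
      rw [Nat.mul_sub, ← pow_add, mul_one, Nat.add_sub_cancel' hk.le]
    have hP : 0 < ∏ i : Fin k, (q ^ k - q ^ i.val) :=
      Finset.prod_pos fun i _ => Nat.sub_pos_of_lt (Nat.pow_lt_pow_right hq i.2)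
    simp only [Fin.val_castSucc, Fin.val_last, Fin.val_zero, pow_zero] at h2
    rw [h3, ← h1, h4] at h2
    have h5 : 0 < q ^ k * ∏ i : Fin k, (q ^ k - q ^ i.val) := by positivity
    refine Nat.eq_of_mul_eq_mul_right h5 ?_
    linarith
  · have : IsEmpty {W : Submodule K V // finrank K W = k + 1} :=
      ⟨fun W => by have := W.1.finrank_le; have := W.2; omega⟩
    simp [Nat.sub_eq_zero_of_le hk]

theorem two_mul_card_finrank_eq_le {k : ℕ} (hk : 2 * k + 2 ≤ finrank K V) :
    2 * Nat.card {W : Submodule K V // finrank K W = k} ≤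
      Nat.card {W : Submodule K V // finrank K W = k + 1} := by
  have hq : 1 < Nat.card K := Finite.one_lt_card
  have h := card_finrank_eq_succ_mul K V k
  have h1 : Nat.card K ^ (k + 1) * 2 ≤ Nat.card K ^ (finrank K V - k) :=
    (Nat.mul_le_mul_left _ hq).trans (by
      rw [← pow_succ]; exact Nat.pow_le_pow_right hq.le (by omega))
  have h2 : 1 < Nat.card K ^ (k + 1) := Nat.one_lt_pow (by omega) hq
  refine Nat.le_of_mul_le_mul_right (c := Nat.card K ^ (k + 1) - 1) ?_ (by omega)
  rw [h, mul_comm 2, mul_assoc]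
  exact Nat.mul_le_mul_left _ (by omega)

theorem card_finrank_eq_succ_le {k : ℕ} (hk : finrank K V ≤ 2 * k + 1) :
    Nat.card {W : Submodule K V // finrank K W = k + 1} ≤
      Nat.card {W : Submodule K V // finrank K W = k} := by
  have hq : 1 < Nat.card K := Finite.one_lt_card
  have h := card_finrank_eq_succ_mul K V k
  have h1 : Nat.card K ^ (finrank K V - k) ≤ Nat.card K ^ (k + 1) :=
    Nat.pow_le_pow_right hq.le (by omega)
  have h2 : 1 < Nat.card K ^ (k + 1) := Nat.one_lt_pow (by omega) hq
  refine Nat.le_of_mul_le_mul_right (c := Nat.card K ^ (k + 1) - 1) ?_ (by omega)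
  rw [h]
  exact Nat.mul_le_mul_left _ (by omega)

theorem two_mul_card_finrank_eq_succ_le {k : ℕ} (hk : finrank K V ≤ 2 * k) :
    2 * Nat.card {W : Submodule K V // finrank K W = k + 1} ≤
      Nat.card {W : Submodule K V // finrank K W = k} := by
  have hq : 1 < Nat.card K := Finite.one_lt_card
  have h := card_finrank_eq_succ_mul K V k
  have h1 : Nat.card K ^ (finrank K V - k) * 2 ≤ Nat.card K ^ (k + 1) := by
    rw [pow_succ]
    exact Nat.mul_le_mul (Nat.pow_le_pow_right hq.le (by omega)) hq
  have h2 : 1 < Nat.card K ^ (k + 1) := Nat.one_lt_pow (by omega) hq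
  refine Nat.le_of_mul_le_mul_right (c := Nat.card K ^ (k + 1) - 1) ?_ (by omega)
  rw [mul_assoc, h, mul_left_comm]
  exact Nat.mul_le_mul_left _ (by
    have := Nat.one_le_pow (finrank K V - k) _ (zero_lt_one.trans hq)
    omega)

theorem card_finrank_eq_le_half (k : ℕ) :
    Nat.card {W : Submodule K V // finrank K W = k} ≤
      Nat.card {W : Submodule K V // finrank K W = finrank K V / 2} := by
  set n := finrank K V
  let L : ℕ → ℕ := fun k => Nat.card {W : Submodule K V // finrank K W = k}
  change L k ≤ L (n / 2)
  rcases lt_trichotomy k (n / 2) with hk | rfl | hk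
  · exact (Finset.single_le_sum (f := L) (fun _ _ => Nat.zero_le _) (mem_range.2 hk)).trans
      (sum_range_le_of_two_mul_le fun i hi => two_mul_card_finrank_eq_le K V (by omega))
  · exact le_rfl
  · have h1 := sum_range_add_two_mul_le (L := L) (a := n / 2 + 1)
      (fun i hi => two_mul_card_finrank_eq_succ_le K V (by omega)) (k - (n / 2 + 1))
    rw [Nat.add_sub_cancel' hk] at h1
    have h2 : L (n / 2 + 1) ≤ L (n / 2) := card_finrank_eq_succ_le K V (by omega)
    omega

theorem card_le_four_mul_card_finrank_eq_half :
    Nat.card (Submodule K V) ≤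
      4 * Nat.card {W : Submodule K V // finrank K W = finrank K V / 2} := by
  have : Finite V := Module.finite_of_finite K
  set n := finrank K V with hn
  let L : ℕ → ℕ := fun k => Nat.card {W : Submodule K V // finrank K W = k}
  have hV : Nat.card (Submodule K V) = ∑ k ∈ range (n + 1), L k := by
    classical
    have := Fintype.ofFinite (Submodule K V)
    rw [Nat.card_eq_fintype_card, ← Finset.card_univ, Finset.card_eq_sum_card_fiberwise
      (f := fun W : Submodule K V => finrank K W) (t := range (n + 1))
      fun W _ => by simpa [Nat.lt_succ_iff] using W.finrank_le]
    exact Finset.sum_congr rfl fun k _ => by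
      simp only [L]
      rw [Nat.card_eq_fintype_card, Fintype.card_subtype]
  have h0 : ∑ k ∈ range (n / 2), L k ≤ L (n / 2) :=
    sum_range_le_of_two_mul_le fun i hi => two_mul_card_finrank_eq_le K V (by omega)
  have h1 := sum_range_add_two_mul_le (L := L) (a := n / 2 + 1)
    (fun i hi => two_mul_card_finrank_eq_succ_le K V (by omega)) (n - n / 2)
  have h2 : L (n / 2 + 1) ≤ L (n / 2) := card_finrank_eq_succ_le K V (by omega)
  rw [hV, show n + 1 = n / 2 + 1 + (n - n / 2) by omega, sum_range_add, sum_range_succ]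
  change _ ≤ 4 * L (n / 2)
  omega
end

end Submodule

open Finset in
open scoped Classical in
/-- `S x` is thought of as the set of maximal chains (indexed by `G`) passing through `x`. If two
comparable elements rarely lie on a common chain, then a set with few comparable pairs is not much
larger than the bound `N` given by the LYM inequality. -/
theorem sub_mul_card_le_of_flags {α G : Type*} [PartialOrder α] [Fintype G] [Nonempty G]
    (S : α → Finset G) (B : Finset α) {N k t : ℕ}
    (hchain : ∀ g x y, g ∈ S x → g ∈ S y → x ≤ y ∨ y ≤ x)
    (hN : ∀ x ∈ B, Fintype.card G ≤ N * #(S x))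
    (hk : ∀ x ∈ B, ∀ y ∈ B, x < y → k * #(S x ∩ S y) ≤ #(S x) + #(S y))
    (ht : ∀ x ∈ B, #(B.filter fun y => x < y ∨ y < x) < t) :
    (k - t) * #B ≤ k * N := by
  let P := (B ×ˢ B).filter fun p => p.1 < p.2
  have hg (g : G) : #(B.filter fun x => g ∈ S x) ≤
      1 + #(P.filter fun p => g ∈ S p.1 ∩ S p.2) := by
    rcases (B.filter fun x => g ∈ S x).eq_empty_or_nonempty with h | h
    · simp [h]
    · obtain ⟨m, hm⟩ := Finset.exists_minimal h
      rw [← Finset.card_erase_add_one hm.1, add_comm]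
      refine Nat.add_le_add_left (Finset.card_le_card_of_injOn (fun y => (m, y)) ?_ ?_) _
      · intro y hy
        have hmB := Finset.mem_filter.1 hm.1
        simp only [Finset.coe_erase, Finset.coe_filter, Set.mem_sdiff, Set.mem_ofPred_eq,
          Set.mem_singleton_iff] at hy
        have hlt : m < y := by
          rcases hchain g m y hmB.2 hy.1.2 with h1 | h1
          · exact lt_of_le_of_ne h1 (Ne.symm hy.2)
          · exact lt_of_le_of_ne (hm.2 (Finset.mem_filter.2 hy.1) h1) (Ne.symm hy.2)
        simp [P, hmB, hy.1, hlt]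
      · intro y _ y' _ h
        exact congrArg Prod.snd h
  have hsum : ∑ x ∈ B, #(S x) ≤ Fintype.card G + ∑ p ∈ P, #(S p.1 ∩ S p.2) := by
    have h1 : ∑ x ∈ B, #(S x) = ∑ g : G, #(B.filter fun x => g ∈ S x) := by
      simp_rw [Finset.card_filter]
      rw [Finset.sum_comm]
      simp
    have h2 : ∑ p ∈ P, #(S p.1 ∩ S p.2) = ∑ g : G, #(P.filter fun p => g ∈ S p.1 ∩ S p.2) := by
      simp_rw [Finset.card_filter]
      rw [Finset.sum_comm]
      refine Finset.sum_congr rfl fun p _ => ?_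
      rw [← Finset.card_filter, Finset.filter_univ_mem]
    rw [h1, h2, ← Finset.card_univ, Finset.card_eq_sum_ones, ← Finset.sum_add_distrib]
    exact Finset.sum_le_sum fun g _ => hg g
  have hP : k * ∑ p ∈ P, #(S p.1 ∩ S p.2) ≤ t * ∑ x ∈ B, #(S x) := by
    calc k * ∑ p ∈ P, #(S p.1 ∩ S p.2)
        ≤ ∑ p ∈ P, (#(S p.1) + #(S p.2)) := by
          rw [Finset.mul_sum]
          refine Finset.sum_le_sum fun p hp => ?_
          simp only [P, Finset.mem_filter, Finset.mem_product] at hp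
          exact hk _ hp.1.1 _ hp.1.2 hp.2
      _ = ∑ x ∈ B, #(B.filter fun y => x < y ∨ y < x) * #(S x) := by
          simp only [P]
          rw [Finset.sum_add_distrib, Finset.sum_filter, Finset.sum_filter, Finset.sum_product,
            Finset.sum_product_right, ← Finset.sum_add_distrib]
          refine Finset.sum_congr rfl fun x _ => ?_
          simp only [← Finset.sum_filter]
          rw [Finset.sum_const, Finset.sum_const,
            Finset.filter_or, Finset.card_union_of_disjoint, smul_eq_mul, smul_eq_mul, add_mul]
          exact Finset.disjoint_filter.2 fun y _ h h' => lt_asymm h h'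
      _ ≤ _ := by
          rw [Finset.mul_sum]
          exact Finset.sum_le_sum fun x hx => Nat.mul_le_mul_right _ (ht x hx).le
  have h1 : (k - t) * ∑ x ∈ B, #(S x) ≤ k * Fintype.card G := by
    rw [Nat.sub_mul, tsub_le_iff_right]
    calc _ ≤ k * (Fintype.card G + ∑ p ∈ P, #(S p.1 ∩ S p.2)) := Nat.mul_le_mul_left _ hsum
      _ ≤ _ := by rw [mul_add]; exact Nat.add_le_add_left hP _
  have h2 : #B * Fintype.card G ≤ N * ∑ x ∈ B, #(S x) := by
    rw [Finset.mul_sum, ← smul_eq_mul, ← Finset.sum_const]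
    exact Finset.sum_le_sum hN
  refine Nat.le_of_mul_le_mul_right (c := Fintype.card G) ?_ Fintype.card_pos
  calc _ = (k - t) * (#B * Fintype.card G) := mul_assoc _ _ _
    _ ≤ (k - t) * (N * ∑ x ∈ B, #(S x)) := Nat.mul_le_mul_left _ h2
    _ = N * ((k - t) * ∑ x ∈ B, #(S x)) := by ring
    _ ≤ N * (k * Fintype.card G) := Nat.mul_le_mul_left _ h1
    _ = _ := by ring

namespace Submodule

open Module Finset

section

variable {K V : Type*} [Field K] [AddCommGroup V] [Module K V] [FiniteDimensional K V] [Finite K]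

open scoped Classical in
theorem card_le_of_card_comparable_lt {N t : ℕ}
    (hN : Nat.card {W : Submodule K V // finrank K W = finrank K V / 2} = N)
    {B : Finset (Submodule K V)}
    (hbot : ⊥ ∉ B) (ht : ∀ x ∈ B, #(B.filter fun y => x < y ∨ y < x) < t) :
    (Nat.card K ^ (finrank K V / 2 - 1) - t) * #B ≤ Nat.card K ^ (finrank K V / 2 - 1) * N := by
  have : Finite V := Module.finite_of_finite K
  have : Finite (V ≃ₗ[K] V) :=
    Finite.of_injective (fun g : V ≃ₗ[K] V => (g : V → V)) DFunLike.coe_injective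
  have := Fintype.ofFinite (V ≃ₗ[K] V)
  have := Fintype.ofFinite (Submodule K V)
  obtain ⟨c, hc, hcr⟩ := exists_monotone_finrank_eq K V
  have hmap (g h : V ≃ₗ[K] V) (x : Submodule K V) :
      x.map ((g.trans h : V ≃ₗ[K] V) : V →ₗ[K] V) = (x.map (g : V →ₗ[K] V)).map (h : V →ₗ[K] V) := by
    rw [← map_comp]; rfl
  have htrans_inj (h : V ≃ₗ[K] V) : Function.Injective fun g : V ≃ₗ[K] V => g.trans h :=
    fun g g' hgg => by ext v; simpa using congrArg (fun f : V ≃ₗ[K] V => f v) hgg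
  let S (x : Submodule K V) : Finset (V ≃ₗ[K] V) :=
    univ.filter fun g => (c (finrank K x)).map (g : V →ₗ[K] V) = x
  have hSmem (x : Submodule K V) (g : V ≃ₗ[K] V) :
      g ∈ S x ↔ (c (finrank K x)).map (g : V →ₗ[K] V) = x := by simp [S]
  have hq : 1 < Nat.card K := Finite.one_lt_card
  refine sub_mul_card_le_of_flags S B (fun g x y hx hy => ?_) (fun x hx => ?_)
    (fun x hx y hy hxy => ?_) ht
  · rw [hSmem] at hx hy
    rw [← hx, ← hy]
    exact (le_total (finrank K x) (finrank K y)).imp (fun h => map_mono (hc h))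
      fun h => map_mono (hc h)
  · have h := Finset.card_le_mul_card_image_of_maps_to (s := (univ : Finset (V ≃ₗ[K] V)))
      (f := fun g : V ≃ₗ[K] V => (c (finrank K x)).map (g : V →ₗ[K] V))
      (t := univ.filter fun W : Submodule K V => finrank K W = finrank K x)
      (fun g _ => by
        simpa using (LinearEquiv.finrank_map_eq g _).trans (hcr _ x.finrank_le)) #(S x) ?_
    · rw [Finset.card_univ, mul_comm] at h
      refine h.trans (Nat.mul_le_mul_right _ ?_)
      rw [← hN, ← Fintype.card_subtype, ← Nat.card_eq_fintype_card]
      exact card_finrank_eq_le_half K V _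
    · intro W hW
      obtain ⟨h, hh⟩ := exists_linearEquiv_map_eq (Finset.mem_filter.1 hW).2
      refine Finset.card_le_card_of_injOn (fun g : V ≃ₗ[K] V => g.trans h) (fun g hg => ?_)
        (htrans_inj h).injOn
      rw [Finset.mem_coe, Finset.mem_filter] at hg
      rw [Finset.mem_coe, hSmem, hmap, hg.2, hh]
  · have hdim : finrank K x < finrank K y := finrank_lt_finrank_of_lt hxy
    rcases lt_or_ge (finrank K y) (finrank K V / 2) with hy2 | hy2
    · refine le_add_right ((Nat.mul_le_mul_right _ ((Nat.pow_le_pow_right hq.le ?_).trans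
        (pow_le_card_ge_finrank_eq x hdim (by omega)))).trans ?_)
      · omega
      rw [mul_comm, Nat.card_eq_fintype_card, Fintype.card_subtype]
      refine Finset.mul_card_image_le_card_of_maps_to
        (f := fun g : V ≃ₗ[K] V => (c (finrank K y)).map (g : V →ₗ[K] V)) (fun g hg => ?_) _ fun W hW => ?_
      · rw [hSmem] at hg
        refine Finset.mem_filter.2 ⟨mem_univ _, ?_, ?_⟩
        · conv_lhs => rw [← hg]
          exact map_mono (hc hdim.le)
        · exact (LinearEquiv.finrank_map_eq g _).trans (hcr _ y.finrank_le)
      · have hW' := (Finset.mem_filter.1 hW).2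
        obtain ⟨h, hx', hy'⟩ := exists_linearEquiv_map_eq_map_eq hxy.le hW'.1 rfl hW'.2.symm
        refine Finset.card_le_card_of_injOn (fun g : V ≃ₗ[K] V => g.trans h) (fun g hg => ?_)
          (htrans_inj h).injOn
        rw [Finset.mem_coe, Finset.mem_inter, hSmem, hSmem] at hg
        rw [Finset.mem_coe, Finset.mem_filter, hSmem, hmap, hmap, hg.1, hg.2]
        exact ⟨hx', hy'⟩
    · have hx0 : 0 < finrank K x := by
        rw [Nat.pos_iff_ne_zero, Ne, finrank_eq_zero]
        rintro rfl
        exact hbot hx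
      refine le_add_left ((Nat.mul_le_mul_right _ ((Nat.pow_le_pow_right hq.le ?_).trans
        (pow_le_card_le_finrank_eq y hx0 hdim))).trans ?_)
      · omega
      rw [mul_comm, Nat.card_eq_fintype_card, Fintype.card_subtype]
      refine Finset.mul_card_image_le_card_of_maps_to
        (f := fun g : V ≃ₗ[K] V => (c (finrank K x)).map (g : V →ₗ[K] V)) (fun g hg => ?_) _ fun W hW => ?_
      · rw [hSmem] at hg
        refine Finset.mem_filter.2 ⟨mem_univ _, ?_, ?_⟩
        · conv_rhs => rw [← hg]
          exact map_mono (hc hdim.le)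
        · exact (LinearEquiv.finrank_map_eq g _).trans (hcr _ x.finrank_le)
      · have hW' := (Finset.mem_filter.1 hW).2
        obtain ⟨h, hx', hy'⟩ := exists_linearEquiv_map_eq_map_eq hxy.le hW'.1 hW'.2.symm rfl
        refine Finset.card_le_card_of_injOn (fun g : V ≃ₗ[K] V => g.trans h) (fun g hg => ?_)
          (htrans_inj h).injOn
        rw [Finset.mem_coe, Finset.mem_inter, hSmem, hSmem] at hg
        rw [Finset.mem_coe, Finset.mem_filter, hSmem, hmap, hmap, hg.1, hg.2]
        exact ⟨hy', hx'⟩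
end

end Submodule

open Filter Topology in
theorem tendsto_sqrt_mul_rpow_neg_div_four {q : ℝ} (hq : 1 < q) :
    Tendsto (fun n : ℕ => √(n : ℝ) * q ^ (-(n : ℝ) / 4)) atTop (𝓝 0) := by
  have h := (tendsto_rpow_mul_exp_neg_mul_atTop_nhds_zero (1 / 2) (Real.log q / 4)
    (by have := Real.log_pos hq; positivity)).comp tendsto_natCast_atTop_atTop
  refine h.congr fun n => ?_
  simp only [Function.comp_apply]
  rw [Real.sqrt_eq_rpow, Real.rpow_def_of_pos (by linarith : (0 : ℝ) < q)]
  congr 2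
  ring

open Module in
theorem card_antichain_le_of_lt {K V : Type*} [Field K] [AddCommGroup V] [Module K V]
    [FiniteDimensional K V] [Finite K] {N k t : ℕ}
    (hN : Nat.card {W : Submodule K V // finrank K W = finrank K V / 2} = N)
    (hk : Nat.card K ^ (finrank K V / 2 - 1) = k) (ht : 3 ≤ t) (htk : t < k) :
    (Nat.card {A : Finset (Submodule K V) //
      IsAntichain (· ≤ ·) (A : Set (Submodule K V))} : ℝ) ≤
      2 ^ (k * N / (k - t) + 1) * ((t : ℝ) ^ (t : ℝ)⁻¹) ^ (4 * N) := by
  classical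
  have : Finite V := Module.finite_of_finite K
  have := Fintype.ofFinite (Submodule K V)
  have hl : 1 ≤ (t : ℝ) ^ (t : ℝ)⁻¹ :=
    Real.one_le_rpow (by exact_mod_cast (by omega : 1 ≤ t)) (by positivity)
  have h := card_antichains_subset_le t (k * N / (k - t) + 1) _ hl
    (rpow_inv_self_pow_add_one_le ht) (fun B hB => ?_) (Finset.univ : Finset (Submodule K V))
  · rw [Finset.powerset_univ, Finset.card_univ, ← Fintype.card_subtype,
      ← Nat.card_eq_fintype_card, ← Nat.card_eq_fintype_card] at h
    refine h.trans ?_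
    gcongr
    rw [← hN]
    exact Submodule.card_le_four_mul_card_finrank_eq_half K V
  · have h1 := Submodule.card_le_of_card_comparable_lt hN (t := t) (B := B.erase ⊥) (by simp)
      fun x hx => (Finset.card_le_card (Finset.filter_subset_filter _
        (Finset.erase_subset _ _))).trans_lt (hB x (Finset.mem_of_mem_erase hx))
    rw [hk, mul_comm, ← Nat.le_div_iff_mul_le (by omega)] at h1
    exact (Nat.sub_le_iff_le_add.1 Finset.pred_card_le_card_erase).trans (Nat.add_le_add_right h1 1)

theorem natCast_mul_div_sub_le {N k t : ℕ} (h : 2 * t ≤ k) (hk : 0 < k) :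
    ((k * N / (k - t) : ℕ) : ℝ) ≤ (1 + 2 * t / k) * N := by
  have hkt : 0 < k - t := by omega
  have hk0 : (0 : ℝ) < k := by exact_mod_cast hk
  have h' : (2 * t : ℝ) ≤ k := by exact_mod_cast h
  have ht0 : (0 : ℝ) ≤ t := t.cast_nonneg
  refine Nat.cast_div_le.trans ?_
  have hc : ((k - t : ℕ) : ℝ) = k - t := Nat.cast_sub (by omega)
  have hkt' : (0 : ℝ) < k - t := by rw [← hc]; exact_mod_cast hkt
  rw [hc, div_le_iff₀ hkt']
  have h1 : (k : ℝ) ≤ (1 + 2 * t / k) * (k - t) := by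
    have h2 : (1 + 2 * t / k) * (k - t) = (k : ℝ) + t * (k - 2 * t) / k := by field_simp; ring
    rw [h2]
    have : 0 ≤ (t : ℝ) * (k - 2 * t) / k :=
      div_nonneg (mul_nonneg ht0 (by linarith)) hk0.le
    linarith
  have hN : (0 : ℝ) ≤ N := N.cast_nonneg
  push_cast
  nlinarith

open Module in
theorem two_pow_le_card_antichain (K V : Type*) [Field K] [AddCommGroup V] [Module K V]
    [FiniteDimensional K V] [Finite K] (i : ℕ) :
    2 ^ Nat.card {W : Submodule K V // finrank K W = i} ≤
      Nat.card {A : Finset (Submodule K V) //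
        IsAntichain (· ≤ ·) (A : Set (Submodule K V))} := by
  classical
  have : Finite V := Module.finite_of_finite K
  have := Fintype.ofFinite (Submodule K V)
  rw [Nat.card_eq_fintype_card, Fintype.card_subtype, ← Finset.card_powerset,
    Nat.card_eq_fintype_card, Fintype.card_subtype]
  refine Finset.card_le_card fun A hA => Finset.mem_filter.2 ⟨Finset.mem_univ _, ?_⟩
  intro x hx y hy hxy hle
  rw [Finset.mem_powerset] at hA
  refine hxy (Submodule.eq_of_le_of_finrank_eq hle ?_)
  rw [(Finset.mem_filter.1 (hA hx)).2, (Finset.mem_filter.1 (hA hy)).2]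

open Module in
theorem card_antichain_le_rpow {K V : Type*} [Field K] [AddCommGroup V] [Module K V]
    [FiniteDimensional K V] [Finite K] {n q N : ℕ} (hn : finrank K V = n) (hq : Nat.card K = q)
    (hN : Nat.card {W : Submodule K V // finrank K W = n / 2} = N) (hn9 : 9 ≤ n)
    (hε : √(n : ℝ) * (q : ℝ) ^ (-(n : ℝ) / 4) ≤ 1 / (4 * (q : ℝ) ^ 2)) :
    (Nat.card {A : Finset (Submodule K V) //
      IsAntichain (· ≤ ·) (A : Set (Submodule K V))} : ℝ) ≤
      2 ^ ((1 + (4 * (q : ℝ) ^ 2 + 1 + 4 * (Real.log q / Real.log 2)) * √(n : ℝ) *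
        (q : ℝ) ^ (-(n : ℝ) / 4)) * N) := by
  have hq1 : 1 < q := hq ▸ Finite.one_lt_card
  have hq1' : (1 : ℝ) < q := by exact_mod_cast hq1
  have hq0 : (0 : ℝ) < q := by linarith
  set ε := √(n : ℝ) * (q : ℝ) ^ (-(n : ℝ) / 4) with hεdef
  set s := √(n : ℝ) * (q : ℝ) ^ ((n : ℝ) / 4) with hs
  have hsqrt : 3 ≤ √(n : ℝ) := by
    rw [Real.le_sqrt' (by norm_num)]
    exact_mod_cast (by omega : 3 ^ 2 ≤ n)
  have hs3 : 3 ≤ s := hsqrt.trans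
    (le_mul_of_one_le_right (by positivity) (Real.one_le_rpow hq1'.le (by positivity)))
  have hs0 : 0 < s := by linarith
  have hε0 : 0 < ε := by positivity
  have hsε : s * ε = n := by
    rw [hs, hεdef, mul_mul_mul_comm, Real.mul_self_sqrt (Nat.cast_nonneg n), ← Real.rpow_add hq0]
    rw [show (n : ℝ) / 4 + -n / 4 = 0 by ring, Real.rpow_zero, mul_one]
  obtain ⟨t, hst, hts⟩ : ∃ t : ℕ, s ≤ t ∧ (t : ℝ) ≤ 2 * s :=
    ⟨⌈s⌉₊, Nat.le_ceil s, by linarith [Nat.ceil_lt_add_one hs0.le]⟩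
  have ht3 : 3 ≤ t := by exact_mod_cast hs3.trans hst
  have ht0 : (0 : ℝ) < t := by linarith
  obtain ⟨k, hk⟩ : ∃ k : ℕ, q ^ (n / 2 - 1) = k := ⟨_, rfl⟩
  have hk0 : 0 < k := hk ▸ by positivity
  have hk0' : (0 : ℝ) < k := by exact_mod_cast hk0
  have hsk : s ≤ q ^ 2 * ε * k := by
    have h1 : ((q : ℝ) ^ 2 * (q : ℝ) ^ (-(n : ℝ) / 4)) * k =
        (q : ℝ) ^ ((2 : ℕ) + -(n : ℝ) / 4 + ((n / 2 - 1 : ℕ) : ℝ)) := by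
      rw [← hk, Real.rpow_add hq0, Real.rpow_add hq0, Real.rpow_natCast, Real.rpow_natCast]
      push_cast
      rfl
    have h2 : (n : ℝ) ≤ 2 * ((n / 2 - 1 : ℕ) : ℝ) + 3 := by
      exact_mod_cast (by omega : n ≤ 2 * (n / 2 - 1) + 3)
    calc s ≤ √(n : ℝ) * (q : ℝ) ^ ((2 : ℕ) + -(n : ℝ) / 4 + ((n / 2 - 1 : ℕ) : ℝ)) := by
          rw [hs]
          gcongr
          · exact hq1'.le
          · push_cast; linarith
      _ = _ := by rw [← h1, hεdef]; ring
  have htk : (2 * t : ℝ) ≤ 4 * q ^ 2 * ε * k := by nlinarith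
  have h2tk : 2 * t ≤ k := by
    have h1 : 4 * (q : ℝ) ^ 2 * ε ≤ 1 := by
      rw [le_div_iff₀ (by positivity)] at hε
      linarith
    exact_mod_cast htk.trans (mul_le_of_le_one_left hk0'.le h1)
  have hNε : 1 ≤ ε * N := by
    have h1 : q ^ (n - n / 2) ≤ N := by
      have := Submodule.card_pow_le_card_finrank_eq (K := K) (V := V) (k := n / 2)
        (l := n - n / 2) (by omega)
      rw [hN, hq] at this
      exact (Nat.pow_le_pow_right hq1.le (Nat.le_mul_of_pos_left _ (by omega))).trans this
    have h2 : (q : ℝ) ^ ((n : ℝ) / 4) ≤ N := by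
      refine le_trans ?_ (Nat.cast_le.2 h1)
      rw [Nat.cast_pow, ← Real.rpow_natCast]
      refine Real.rpow_le_rpow_of_exponent_le hq1'.le ?_
      have : (n : ℝ) ≤ 4 * (n - n / 2 : ℕ) := by
        exact_mod_cast (by omega : n ≤ 4 * (n - n / 2))
      linarith
    calc (1 : ℝ) ≤ √(n : ℝ) := by linarith
      _ = ε * (q : ℝ) ^ ((n : ℝ) / 4) := by
        rw [hεdef, mul_assoc, ← Real.rpow_add hq0]
        rw [show -(n : ℝ) / 4 + n / 4 = 0 by ring, Real.rpow_zero, mul_one]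
      _ ≤ _ := by gcongr
  have hlog : Real.log t / t ≤ Real.log q * ε := by
    have h1 : (t : ℝ) ≤ (q : ℝ) ^ n := by
      have : t ≤ q ^ n := calc
        t ≤ k := by omega
        _ ≤ q ^ n := hk ▸ Nat.pow_le_pow_right hq1.le (by omega)
      exact_mod_cast this
    have h2 : Real.log t ≤ n * Real.log q := by
      rw [← Real.log_pow]
      exact Real.log_le_log ht0 h1
    have h3 : 0 < Real.log q := Real.log_pos hq1'
    rw [div_le_iff₀ ht0]
    calc _ ≤ n * Real.log q := h2
      _ = Real.log q * ε * s := by rw [← hsε]; ring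
      _ ≤ _ := by gcongr
  have hlog2 : 0 < Real.log 2 := Real.log_pos (by norm_num)
  refine (card_antichain_le_of_lt (N := N) (k := k) (by rw [hn]; exact hN)
    (by rw [hn, hq]; exact hk) ht3 (by omega)).trans ?_
  have hl : ((t : ℝ) ^ (t : ℝ)⁻¹) ^ (4 * N) =
      2 ^ (Real.log t / t / Real.log 2 * (4 * N)) := by
    rw [← Real.rpow_natCast, ← Real.rpow_mul ht0.le, Real.rpow_def_of_pos ht0,
      Real.rpow_def_of_pos (by norm_num : (0 : ℝ) < 2)]
    congr 1
    push_cast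
    field_simp
  rw [hl, ← Real.rpow_natCast, ← Real.rpow_add (by norm_num)]
  refine Real.rpow_le_rpow_of_exponent_le (by norm_num) ?_
  have h1 := natCast_mul_div_sub_le (N := N) h2tk hk0
  have h2 : 2 * t / k * (N : ℝ) ≤ 4 * q ^ 2 * ε * N := by
    gcongr
    rwa [div_le_iff₀ hk0']
  have h3 : Real.log t / t / Real.log 2 * (4 * N) ≤ Real.log q * ε / Real.log 2 * (4 * N) := by
    gcongr
  calc _ ≤ (1 + 4 * q ^ 2 * ε) * N + ε * N + Real.log q * ε / Real.log 2 * (4 * N) := by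
        push_cast; linarith
    _ = _ := by rw [hεdef]; ring

/-- The number of antichains in the poset of subspaces of `F_q^n` is
`2^{(1 + O(√n q^{-n/4})) [n choose ⌊n/2⌋]_q}`. -/
theorem countAntichainsVecSp (q : ℕ) (hq : IsPrimePow q) :
    ∃ C : ℝ, 0 < C ∧ ∃ n0 : ℕ, ∀ n : ℕ, n0 ≤ n →
      ∀ (F : Type) [Field F] [Fintype F], Fintype.card F = q →
        2 ^ gaussBinom F n (n / 2) ≤
          Nat.card {A : Finset (Submodule F (Fin n → F)) //
            IsAntichain (· ≤ ·) (A : Set (Submodule F (Fin n → F)))} ∧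
        (Nat.card {A : Finset (Submodule F (Fin n → F)) //
            IsAntichain (· ≤ ·) (A : Set (Submodule F (Fin n → F)))} : ℝ) ≤
          (2 : ℝ) ^ ((1 + C * Real.sqrt n * (q : ℝ) ^ (-(n : ℝ) / 4)) *
            (gaussBinom F n (n / 2) : ℝ)) := by
  have hq1 : (1 : ℝ) < q := by exact_mod_cast hq.one_lt
  have hC : 0 < 4 * (q : ℝ) ^ 2 + 1 + 4 * (Real.log q / Real.log 2) := by
    have := Real.log_pos hq1
    have := Real.log_pos one_lt_two
    positivity
  obtain ⟨n0, hn0⟩ := Filter.eventually_atTop.1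
    ((tendsto_sqrt_mul_rpow_neg_div_four hq1).eventually_le_const
      (show (0 : ℝ) < 1 / (4 * (q : ℝ) ^ 2) by positivity))
  refine ⟨_, hC, max 9 n0, fun n hn F _ _ hF => ⟨two_pow_le_card_antichain _ _ _, ?_⟩⟩
  exact card_antichain_le_rpow (by simp) (by rw [Nat.card_eq_fintype_card, hF]) rfl
    (le_of_max_le_left hn) (hn0 n (le_of_max_le_right hn))
end
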